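/- Suppose f₀ is a positive Radon measure on (0,∞) with ‖f₀‖ < ∞ and ∫_{(0,∞)} ξ^θ df₀(ξ) < ∞ for some θ > β + 1. Then there exists a family (f(t))_{t≥0} of positive Radon measures on (0,∞) with f(0) = f₀ such that for every continuous φ : [0,∞) → ℝ with φ(ξ) = O(ξ) as ξ → ∞, the map t ↦ ∫_{(0,∞)} φ(ξ) df(t)(ξ) is continuous and for every t ≥ 0 one has ∫ φ df(t) − ∫ φ df₀ = ∫₀^t [ (1/2)·∬_{(0,∞)²} K(ξ,η)·(φ(ξ+η) − φ(ξ) − φ(η)) df(s)(ξ) df(s)(η) − (1/4)·∫_{(0,∞)} γ(η)·(φ(η) − 2φ(η/2)) df(s)(η) ] ds. Moreover, for every T > 0 there is a constant C(T, f₀), depending on T, f₀ and the kernels, with sup_{0≤t≤T} ‖f(t)‖ ≤ C(T, f₀) and sup_{0≤t≤T} ∫_{(0,∞)} ξ^θ df(t)(ξ) ≤ C(T, f₀). -/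

import Mathlib

open Filter Topology Asymptotics MeasureTheory

noncomputable section

/-- The coagulation kernel `K(ξ,η) = (ξ+η)⁻¹ k((ξ+η)/2) Q(2η/(ξ+η) − 1)`. -/
def Kker (k Q : ℝ → ℝ) (ξ η : ℝ) : ℝ :=
  (ξ + η)⁻¹ * k ((ξ + η) / 2) * Q (2 * η / (ξ + η) - 1)

/-- The norm `‖f‖ = sup_{n<0} 2^{−n} f([2^n,2^{n+1})) + f([1,∞))` on positive measures. -/
def Mnorm (μ : Measure ℝ) : ENNReal :=
  (⨆ n : {m : ℤ // m < 0},
    (2:ENNReal) ^ (-n.1) * μ (Set.Ico ((2:ℝ) ^ n.1) ((2:ℝ) ^ (n.1 + 1)))) +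
  μ (Set.Ici 1)

/-- The weight `1 + |x|^θ` controlling number and `θ`-moment at once. -/
def momentWeight (θ x : ℝ) : ℝ := 1 + |x| ^ θ

lemma momentWeight_pos (θ x : ℝ) : 0 < momentWeight θ x := by
  unfold momentWeight; positivity

lemma one_le_momentWeight (θ x : ℝ) : 1 ≤ momentWeight θ x := by
  unfold momentWeight; linarith [Real.rpow_nonneg (abs_nonneg x) θ]

lemma rpow_le_momentWeight {p θ : ℝ} (hp : 0 ≤ p) (hpθ : p ≤ θ) (x : ℝ) :
    |x| ^ p ≤ momentWeight θ x := by
  unfold momentWeight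
  rcases le_total |x| 1 with h | h
  · linarith [Real.rpow_le_one (abs_nonneg x) h hp, Real.rpow_nonneg (abs_nonneg x) θ]
  · linarith [Real.rpow_le_rpow_of_exponent_le h hpθ]

lemma continuous_momentWeight {θ : ℝ} (hθ : 0 ≤ θ) : Continuous (momentWeight θ) := by
  unfold momentWeight
  exact continuous_const.add (continuous_abs.rpow_const fun _ => Or.inr hθ)

/-- `μ` has number plus `θ`-moment at most `B` and gives mass at most `B R` to `(-∞, R]`. -/
structure SizeBound (θ B : ℝ) (μ : Measure ℝ) : Prop where
  nonneg : 0 ≤ B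
  mom : ∫⁻ x, ENNReal.ofReal (momentWeight θ x) ∂μ ≤ ENNReal.ofReal B
  small : ∀ R : ℝ, 0 < R → μ (Set.Iic R) ≤ ENNReal.ofReal (B * R)

/-- Convergence of measures tested against compactly supported continuous functions. -/
def VagueTendsto {ι : Type*} (l : Filter ι) (μ : ι → Measure ℝ) (ν : Measure ℝ) : Prop :=
  ∀ φ : ℝ → ℝ, Continuous φ → HasCompactSupport φ →
    Tendsto (fun i => ∫ x, φ x ∂(μ i)) l (𝓝 (∫ x, φ x ∂ν))

namespace SizeBound

variable {θ B : ℝ} {μ : Measure ℝ}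

lemma mono {B' : ℝ} (h : SizeBound θ B μ) (hB : B ≤ B') : SizeBound θ B' μ where
  nonneg := h.nonneg.trans hB
  mom := h.mom.trans (ENNReal.ofReal_le_ofReal hB)
  small R hR := (h.small R hR).trans (ENNReal.ofReal_le_ofReal (by gcongr))

lemma measure_univ_le (h : SizeBound θ B μ) : μ Set.univ ≤ ENNReal.ofReal B := by
  refine le_trans ?_ h.mom
  rw [← lintegral_one]
  exact lintegral_mono fun x => by
    simpa using ENNReal.ofReal_le_ofReal (one_le_momentWeight θ x)

lemma isFiniteMeasure (h : SizeBound θ B μ) : IsFiniteMeasure μ :=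
  ⟨h.measure_univ_le.trans_lt ENNReal.ofReal_lt_top⟩

lemma real_univ_le (h : SizeBound θ B μ) : μ.real Set.univ ≤ B :=
  ENNReal.toReal_le_of_le_ofReal h.nonneg h.measure_univ_le

lemma real_Iic_le (h : SizeBound θ B μ) {R : ℝ} (hR : 0 < R) : μ.real (Set.Iic R) ≤ B * R :=
  ENNReal.toReal_le_of_le_ofReal (mul_nonneg h.nonneg hR.le) (h.small R hR)

lemma measure_Iic_zero (h : SizeBound θ B μ) : μ (Set.Iic 0) = 0 := by
  have h1 : Tendsto (fun R : ℝ => ENNReal.ofReal (B * R)) (𝓝[>] 0) (𝓝 0) := by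
    have : Tendsto (fun R : ℝ => ENNReal.ofReal (B * R)) (𝓝 0) (𝓝 (ENNReal.ofReal (B * 0))) :=
      (ENNReal.continuous_ofReal.comp (continuous_const.mul continuous_id)).tendsto 0
    simpa using this.mono_left nhdsWithin_le_nhds
  refine le_antisymm (ge_of_tendsto h1 ?_) zero_le
  filter_upwards [self_mem_nhdsWithin] with R hR
  exact (measure_mono (Set.Iic_subset_Iic.2 (le_of_lt hR))).trans (h.small R hR)

lemma ae_pos (h : SizeBound θ B μ) : ∀ᵐ x ∂μ, 0 < x := by
  rw [ae_iff]; simpa [Set.Iic_def] using h.measure_Iic_zero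

lemma restrict_Ioi (h : SizeBound θ B μ) : μ.restrict (Set.Ioi 0) = μ :=
  Measure.restrict_eq_self_of_ae_mem h.ae_pos

lemma integrable_weight (h : SizeBound θ B μ) (hθ : 0 ≤ θ) :
    Integrable (momentWeight θ) μ := by
  refine ⟨(continuous_momentWeight hθ).aestronglyMeasurable, ?_⟩
  rw [hasFiniteIntegral_iff_ofReal (Eventually.of_forall fun x => (momentWeight_pos θ x).le)]
  exact h.mom.trans_lt ENNReal.ofReal_lt_top

lemma integral_weight_le (h : SizeBound θ B μ) (hθ : 0 ≤ θ) :
    ∫ x, momentWeight θ x ∂μ ≤ B := by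
  rw [integral_eq_lintegral_of_nonneg_ae
    (Eventually.of_forall fun x => (momentWeight_pos θ x).le)
    (continuous_momentWeight hθ).aestronglyMeasurable]
  exact ENNReal.toReal_le_of_le_ofReal h.nonneg h.mom

lemma integrable_of_le (h : SizeBound θ B μ) (hθ : 0 ≤ θ) {ψ : ℝ → ℝ}
    (hm : AEStronglyMeasurable ψ μ) {c : ℝ} (hψ : ∀ x, |ψ x| ≤ c * momentWeight θ x) :
    Integrable ψ μ :=
  ((h.integrable_weight hθ).const_mul c).mono' hm (Eventually.of_forall hψ)

lemma abs_integral_le (h : SizeBound θ B μ) (hθ : 0 ≤ θ) {ψ : ℝ → ℝ}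
    {c : ℝ} (hc : 0 ≤ c) (hψ : ∀ x, |ψ x| ≤ c * momentWeight θ x) :
    |∫ x, ψ x ∂μ| ≤ c * B := by
  have := norm_integral_le_of_norm_le (f := ψ) ((h.integrable_weight hθ).const_mul c)
    (Eventually.of_forall hψ)
  rw [integral_const_mul] at this
  exact this.trans (by gcongr; exact h.integral_weight_le hθ)

end SizeBound

/-- A continuous cutoff equal to `1` on `[-R, R]` and to `0` outside `[-R-1, R+1]`. -/
def plateau (R x : ℝ) : ℝ := max 0 (min 1 (R + 1 - |x|))

lemma continuous_plateau (R : ℝ) : Continuous (plateau R) := by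
  unfold plateau; fun_prop

lemma plateau_nonneg (R x : ℝ) : 0 ≤ plateau R x := le_max_left _ _

lemma plateau_le_one (R x : ℝ) : plateau R x ≤ 1 := max_le zero_le_one (min_le_left _ _)

lemma plateau_eq_one {R x : ℝ} (h : |x| ≤ R) : plateau R x = 1 := by
  unfold plateau; rw [min_eq_left (by linarith), max_eq_right zero_le_one]

lemma plateau_eq_zero {R x : ℝ} (h : R + 1 ≤ |x|) : plateau R x = 0 := by
  unfold plateau; exact max_eq_left ((min_le_right _ _).trans (by linarith))

lemma hasCompactSupport_plateau (R : ℝ) : HasCompactSupport (plateau R) := by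
  refine HasCompactSupport.intro (isCompact_closedBall (0 : ℝ) (R + 1)) fun x hx => ?_
  refine plateau_eq_zero ?_
  simp only [Metric.mem_closedBall, dist_zero_right, Real.norm_eq_abs, not_le] at hx
  exact hx.le

lemma tendsto_of_forall_approx {ι : Type*} {l : Filter ι} {u : ι → ℝ} {a C : ℝ}
    (h : ∀ ε > 0, ∃ (v : ι → ℝ) (b : ℝ), Tendsto v l (𝓝 b) ∧
      (∀ᶠ i in l, |u i - v i| ≤ C * ε) ∧ |a - b| ≤ C * ε) : Tendsto u l (𝓝 a) := by
  rw [Metric.tendsto_nhds]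
  intro ε hε
  have hC : 0 < 3 * (|C| + 1) := by positivity
  obtain ⟨v, b, hv, huv, hab⟩ := h (ε / (3 * (|C| + 1))) (by positivity)
  have hle : C * (ε / (3 * (|C| + 1))) < ε / 3 := by
    rw [mul_div_assoc', div_lt_div_iff₀ hC (by norm_num)]
    nlinarith [le_abs_self C]
  filter_upwards [huv, Metric.tendsto_nhds.1 hv (ε / 3) (by positivity)] with i h1 h2
  rw [Real.dist_eq] at h2 ⊢
  have e : u i - a = (u i - v i) + (v i - b) - (a - b) := by ring
  rw [e]
  have := abs_sub (u i - v i + (v i - b)) (a - b)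
  have := abs_add_le (u i - v i) (v i - b)
  linarith

lemma tendsto_integral_of_vague {ι : Type*} {l : Filter ι} {μ : ι → Measure ℝ} {ν : Measure ℝ}
    {θ B : ℝ} (hθ : 0 ≤ θ) (hμ : ∀ᶠ i in l, SizeBound θ B (μ i)) (hν : SizeBound θ B ν)
    (hv : VagueTendsto l μ ν) {ψ : ℝ → ℝ} (hψ : Continuous ψ)
    (hdec : ∀ ε > 0, ∃ R : ℝ, ∀ x, R ≤ |x| → |ψ x| ≤ ε * momentWeight θ x) :
    Tendsto (fun i => ∫ x, ψ x ∂(μ i)) l (𝓝 (∫ x, ψ x ∂ν)) := by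
  refine tendsto_of_forall_approx (C := B) fun ε hε => ?_
  obtain ⟨R, hR⟩ := hdec ε hε
  have hcs : HasCompactSupport fun x => plateau R x * ψ x := (hasCompactSupport_plateau R).mul_right
  have hcont : Continuous fun x => plateau R x * ψ x := (continuous_plateau R).mul hψ
  have key : ∀ x, |ψ x - plateau R x * ψ x| ≤ ε * momentWeight θ x := by
    intro x
    rcases le_total R |x| with h | h
    · refine le_trans ?_ (hR x h)
      rw [show ψ x - plateau R x * ψ x = (1 - plateau R x) * ψ x by ring, abs_mul,
        abs_of_nonneg (by linarith [plateau_le_one R x])]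
      exact mul_le_of_le_one_left (abs_nonneg _) (by linarith [plateau_nonneg R x])
    · rw [plateau_eq_one h]; simp only [one_mul, sub_self, abs_zero]
      exact mul_nonneg hε.le (momentWeight_pos θ x).le
  have est : ∀ m : Measure ℝ, SizeBound θ B m →
      |(∫ x, ψ x ∂m) - ∫ x, plateau R x * ψ x ∂m| ≤ B * ε := by
    intro m hm
    have := hm.isFiniteMeasure
    have i2 : Integrable (fun x => plateau R x * ψ x) m :=
      hcont.integrable_of_hasCompactSupport hcs
    have i3 : Integrable (fun x => ψ x - plateau R x * ψ x) m :=
      hm.integrable_of_le hθ (hψ.sub hcont).aestronglyMeasurable key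
    have i1 : Integrable ψ m := (i3.add i2).congr (Eventually.of_forall fun x => by simp)
    rw [← integral_sub i1 i2, mul_comm]
    exact hm.abs_integral_le hθ hε.le key
  exact ⟨_, _, hv _ hcont hcs, hμ.mono fun i hi => est _ hi, est _ hν⟩

lemma lintegral_le_of_vague {ι : Type*} {l : Filter ι} [l.NeBot] {μ : ι → Measure ℝ}
    {ν : Measure ℝ} [IsFiniteMeasure ν] (hfin : ∀ᶠ i in l, IsFiniteMeasure (μ i))
    (hv : VagueTendsto l μ ν) {ψ : ℝ → ℝ} (hψ : Continuous ψ) (h0 : ∀ x, 0 ≤ ψ x) {B : ℝ}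
    (hB : 0 ≤ B) (hle : ∀ᶠ i in l, ∫⁻ x, ENNReal.ofReal (ψ x) ∂(μ i) ≤ ENNReal.ofReal B) :
    ∫⁻ x, ENNReal.ofReal (ψ x) ∂ν ≤ ENNReal.ofReal B := by
  have hcont : ∀ n : ℕ, Continuous fun x => plateau n x * ψ x :=
    fun n => (continuous_plateau _).mul hψ
  have hcs : ∀ n : ℕ, HasCompactSupport fun x => plateau n x * ψ x :=
    fun n => (hasCompactSupport_plateau _).mul_right
  have hnn : ∀ (n : ℕ) x, 0 ≤ plateau n x * ψ x := fun n x => mul_nonneg (plateau_nonneg _ _) (h0 x)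
  have hn : ∀ n : ℕ, ∫⁻ x, ENNReal.ofReal (plateau n x * ψ x) ∂ν ≤ ENNReal.ofReal B := by
    intro n
    rw [← ofReal_integral_eq_lintegral_ofReal
      ((hcont n).integrable_of_hasCompactSupport (hcs n)) (Eventually.of_forall (hnn n))]
    refine ENNReal.ofReal_le_ofReal (le_of_tendsto (hv _ (hcont n) (hcs n)) ?_)
    filter_upwards [hle, hfin] with i hi hf
    rw [integral_eq_lintegral_of_nonneg_ae (Eventually.of_forall (hnn n))
      (hcont n).aestronglyMeasurable]
    refine ENNReal.toReal_le_of_le_ofReal hB (le_trans (lintegral_mono fun x => ?_) hi)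
    exact ENNReal.ofReal_le_ofReal (mul_le_of_le_one_left (h0 x) (plateau_le_one _ _))
  have hlim : ∀ x, Tendsto (fun n : ℕ => ENNReal.ofReal (plateau n x * ψ x)) atTop
      (𝓝 (ENNReal.ofReal (ψ x))) := by
    intro x
    refine tendsto_const_nhds.congr' ?_
    filter_upwards [eventually_ge_atTop ⌈|x|⌉₊] with n hn
    rw [plateau_eq_one ((Nat.le_ceil _).trans (by exact_mod_cast hn)), one_mul]
  calc ∫⁻ x, ENNReal.ofReal (ψ x) ∂ν
      = ∫⁻ x, liminf (fun n : ℕ => ENNReal.ofReal (plateau n x * ψ x)) atTop ∂ν :=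
        lintegral_congr fun x => (hlim x).liminf_eq.symm
    _ ≤ liminf (fun n : ℕ => ∫⁻ x, ENNReal.ofReal (plateau n x * ψ x) ∂ν) atTop :=
        lintegral_liminf_le fun n => (hcont n).measurable.ennreal_ofReal
    _ ≤ ENNReal.ofReal B := by
        refine (liminf_le_liminf (Eventually.of_forall hn)).trans ?_
        simp

lemma SizeBound.of_vague {ι : Type*} {l : Filter ι} [l.NeBot] {μ : ι → Measure ℝ}
    {ν : Measure ℝ} [IsFiniteMeasure ν] {θ B : ℝ} (hθ : 0 ≤ θ)
    (hμ : ∀ᶠ i in l, SizeBound θ B (μ i)) (hv : VagueTendsto l μ ν) :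
    SizeBound θ (2 * B) ν := by
  obtain ⟨i₀, hi₀⟩ := hμ.exists
  have hB := hi₀.nonneg
  have hfin : ∀ᶠ i in l, IsFiniteMeasure (μ i) := hμ.mono fun i hi => hi.isFiniteMeasure
  refine ⟨by linarith, ?_, fun R hR => ?_⟩
  · refine (lintegral_le_of_vague hfin hv (continuous_momentWeight hθ)
      (fun x => (momentWeight_pos θ x).le) hB (hμ.mono fun i hi => hi.mom)).trans
      (ENNReal.ofReal_le_ofReal (by linarith))
  · have hψ : Continuous fun x : ℝ => max 0 (min 1 (2 - x / R)) := by fun_prop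
    have := lintegral_le_of_vague hfin hv hψ (fun x => le_max_left _ _)
      (B := 2 * B * R) (by positivity) ?_
    · refine le_trans ?_ this
      rw [← lintegral_indicator_one measurableSet_Iic]
      refine lintegral_mono fun x => ?_
      by_cases hx : x ≤ R
      · have : x / R ≤ 1 := (div_le_one hR).2 hx
        simp [hx, min_eq_left (show (1:ℝ) ≤ 2 - x / R by linarith)]
      · simp [hx]
    · filter_upwards [hμ] with i hi
      rw [show 2 * B * R = B * (2 * R) by ring]
      refine le_trans ?_ (hi.small (2 * R) (by positivity))
      rw [← lintegral_indicator_one measurableSet_Iic]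
      refine lintegral_mono fun x => ?_
      by_cases hx : x ≤ 2 * R
      · simp only [Set.mem_Iic, hx, Set.indicator_of_mem, Pi.one_apply]
        rw [← ENNReal.ofReal_one]
        exact ENNReal.ofReal_le_ofReal (max_le zero_le_one (min_le_left _ _))
      · have : 2 ≤ x / R := (le_div_iff₀ hR).2 (by linarith)
        have : max 0 (min 1 (2 - x / R)) = 0 := max_eq_left ((min_le_right _ _).trans (by linarith))
        simp [this]

lemma exists_vague_limit (U : Ultrafilter ℕ) {μ : ℕ → Measure ℝ} {θ B : ℝ} (hθ : 1 ≤ θ)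
    (hμ : ∀ᶠ n in (U : Filter ℕ), SizeBound θ B (μ n)) :
    ∃ ν : Measure ℝ, SizeBound θ (2 * B) ν ∧ VagueTendsto (U : Filter ℕ) μ ν := by
  classical
  let m : ℕ → FiniteMeasure ℝ := fun n =>
    if h : SizeBound θ B (μ n) then ⟨μ n, h.isFiniteMeasure⟩ else 0
  let u : ℕ → NNReal := fun n => B.toNNReal / ((n + 1 : ℕ) : NNReal)
  let K : ℕ → Set ℝ := fun n => Metric.closedBall 0 (n + 1)
  have hu : Tendsto u atTop (𝓝 0) :=
    (tendsto_const_div_atTop_nhds_zero_nat B.toNNReal).comp (tendsto_add_atTop_nat 1)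
  have hK := isCompact_setOfPred_finiteMeasure_mass_le_compl_isCompact_le (K := K) B.toNNReal hu
    (fun n => isCompact_closedBall _ _) (Or.inl inferInstance)
  have hmem : ∀ n, SizeBound θ B (μ n) → (m n : Measure ℝ) = μ n := by
    intro n h; simp [m, h]
  have hS : ∀ᶠ n in (U : Filter ℕ), m n ∈ {μ : FiniteMeasure ℝ | μ.mass ≤ B.toNNReal ∧
      ∀ n, μ (K n)ᶜ ≤ u n} := by
    filter_upwards [hμ] with n hn
    refine ⟨?_, fun k => ?_⟩
    · rw [← ENNReal.coe_le_coe, FiniteMeasure.ennreal_mass, hmem n hn]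
      exact hn.measure_univ_le
    · rw [← ENNReal.coe_le_coe, FiniteMeasure.ennreal_coeFn_eq_coeFn_toMeasure, hmem n hn,
        ENNReal.coe_div (by positivity), ENNReal.le_div_iff_mul_le (by simp) (by simp), mul_comm]
      have hsub : (K k)ᶜ ⊆ {x | ((k + 1 : ℕ) : ENNReal) ≤ ENNReal.ofReal (momentWeight θ x)} := by
        intro x hx
        simp only [K, Set.mem_compl_iff, Metric.mem_closedBall, dist_zero_right, Real.norm_eq_abs,
          not_le] at hx
        have h1 := rpow_le_momentWeight zero_le_one hθ x
        rw [Real.rpow_one] at h1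
        rw [Set.mem_ofPred_eq, ← ENNReal.ofReal_natCast]
        exact ENNReal.ofReal_le_ofReal (by push_cast; linarith)
      refine le_trans ?_ (le_trans (mul_meas_ge_le_lintegral
        (continuous_momentWeight (by linarith)).measurable.ennreal_ofReal
        ((k + 1 : ℕ) : ENNReal)) hn.mom)
      exact mul_le_mul' (by simp) (measure_mono hsub)
  obtain ⟨ν, -, hν⟩ := hK.ultrafilter_le_nhds (U.map m) (by
    rw [le_principal_iff]; exact hS)
  have htend : Tendsto m U (𝓝 ν) := hν
  rw [FiniteMeasure.tendsto_iff_forall_integral_tendsto] at htend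
  have hv : VagueTendsto (U : Filter ℕ) μ (ν : Measure ℝ) := by
    intro φ hφ hφc
    obtain ⟨C, hC⟩ := hφ.bounded_above_of_compact_support hφc
    refine (htend (BoundedContinuousFunction.ofNormedAddCommGroup φ hφ C hC)).congr' ?_
    filter_upwards [hμ] with n hn
    rw [hmem n hn]; rfl
  exact ⟨ν, SizeBound.of_vague (by linarith) hμ hv, hv⟩

lemma tendsto_double_integral_of_vague {ι : Type*} {l : Filter ι} {μ : ι → Measure ℝ}
    {ν : Measure ℝ} {θ B : ℝ} (hμ : ∀ᶠ i in l, SizeBound θ B (μ i)) (hν : SizeBound θ B ν)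
    (hv : VagueTendsto l μ ν) {G : ℝ → ℝ → ℝ} (hG : Continuous (Function.uncurry G))
    (hGc : HasCompactSupport (Function.uncurry G)) :
    Tendsto (fun i => ∫ x, ∫ y, G x y ∂(μ i) ∂(μ i)) l (𝓝 (∫ x, ∫ y, G x y ∂ν ∂ν)) := by
  have hB := hν.nonneg
  have hGx : ∀ x, Continuous (G x) := fun x => hG.comp (Continuous.prodMk_right x)
  obtain ⟨M, hM⟩ : ∃ M : ℝ, ∀ x y, (M ≤ |x| ∨ M ≤ |y|) → G x y = 0 := by
    obtain ⟨M, hM⟩ := hGc.isBounded.exists_norm_le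
    refine ⟨M + 1, fun x y h => ?_⟩
    by_contra hne
    have := hM (x, y) (subset_tsupport _ hne)
    have h1 : |x| ≤ M := (norm_fst_le (x, y)).trans this
    have h2 : |y| ≤ M := (norm_snd_le (x, y)).trans this
    rcases h with h | h <;> linarith
  have hcsx : ∀ x, HasCompactSupport (G x) := fun x =>
    HasCompactSupport.intro (isCompact_closedBall (0 : ℝ) M) fun y hy => hM x y (Or.inr (by
      simp only [Metric.mem_closedBall, dist_zero_right, Real.norm_eq_abs, not_le] at hy
      exact hy.le))
  have huc : UniformContinuous (Function.uncurry G) := hGc.uniformContinuous_of_continuous hG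
  have hint : ∀ m : Measure ℝ, SizeBound θ B m → ∀ x, Integrable (G x) m := fun m hm x => by
    have := hm.isFiniteMeasure
    exact (hGx x).integrable_of_hasCompactSupport (hcsx x)
  have hclose : ∀ ε > 0, ∃ δ > 0, ∀ x x', |x - x'| < δ → ∀ m : Measure ℝ, SizeBound θ B m →
      |(∫ y, G x y ∂m) - ∫ y, G x' y ∂m| ≤ ε * B := by
    intro ε hε
    obtain ⟨δ, hδ, h⟩ := Metric.uniformContinuous_iff.1 huc ε hε
    refine ⟨δ, hδ, fun x x' hx m hm => ?_⟩
    have := hm.isFiniteMeasure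
    rw [← integral_sub (hint m hm x) (hint m hm x')]
    have := norm_integral_le_of_norm_le_const (μ := m) (f := fun y => G x y - G x' y) (C := ε)
      (Eventually.of_forall fun y => by
        have := h (a := (x, y)) (b := (x', y)) (by simpa [Prod.dist_eq, Real.dist_eq] using hx)
        rw [Real.dist_eq] at this
        exact this.le)
    exact this.trans (by gcongr; exact hm.real_univ_le)
  have hHcont : ∀ m : Measure ℝ, SizeBound θ B m → Continuous fun x => ∫ y, G x y ∂m := by
    intro m hm
    rw [Metric.continuous_iff]
    intro x ε hε
    obtain ⟨δ, hδ, h⟩ := hclose (ε / (2 * (B + 1))) (by positivity)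
    refine ⟨δ, hδ, fun x' hx' => (h x' x hx' m hm).trans_lt ?_⟩
    rw [div_mul_eq_mul_div, div_lt_iff₀ (by positivity)]
    nlinarith
  have hHcs : ∀ m : Measure ℝ, HasCompactSupport fun x => ∫ y, G x y ∂m := fun m =>
    HasCompactSupport.intro (isCompact_closedBall (0 : ℝ) M) fun x hx => by
      simp only [Metric.mem_closedBall, dist_zero_right, Real.norm_eq_abs, not_le] at hx
      simp [hM x _ (Or.inl hx.le)]
  refine tendsto_of_forall_approx (C := (1 + 2 * B) * B) fun ε hε => ?_
  refine ⟨_, _, hv _ (hHcont ν hν) (hHcs ν), ?_, by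
    simp only [sub_self, abs_zero]; positivity⟩
  obtain ⟨δ, hδ, hcl⟩ := hclose ε hε
  obtain ⟨t, -, htf, ht⟩ := (isCompact_closedBall (0 : ℝ) M).finite_cover_balls hδ
  have hev : ∀ᶠ i in l, ∀ z ∈ t, |(∫ y, G z y ∂(μ i)) - ∫ y, G z y ∂ν| < ε := by
    rw [eventually_all_finite htf]
    intro z _
    exact Metric.tendsto_nhds.1 (hv _ (hGx z) (hcsx z)) ε hε
  filter_upwards [hev, hμ] with i hi hm
  have := hm.isFiniteMeasure
  rw [← integral_sub ((hHcont _ hm).integrable_of_hasCompactSupport (hHcs _))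
    ((hHcont ν hν).integrable_of_hasCompactSupport (hHcs ν))]
  have hpt : ∀ x, ‖(∫ y, G x y ∂(μ i)) - ∫ y, G x y ∂ν‖ ≤ ε * (1 + 2 * B) := by
    intro x
    rw [Real.norm_eq_abs]
    by_cases hx : x ∈ Metric.closedBall (0 : ℝ) M
    · obtain ⟨z, hz, hxz⟩ := Set.mem_iUnion₂.1 (ht hx)
      rw [Metric.mem_ball, Real.dist_eq] at hxz
      have h1 := abs_le.1 (hcl x z hxz _ hm)
      have h2 := abs_le.1 (hcl x z hxz _ hν)
      have h3 := abs_lt.1 (hi z hz)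
      rw [abs_le]; constructor <;> nlinarith
    · simp only [Metric.mem_closedBall, dist_zero_right, Real.norm_eq_abs, not_le] at hx
      simp only [hM x _ (Or.inl hx.le), integral_zero, sub_self, abs_zero]
      positivity
  refine (norm_integral_le_of_norm_le_const (Eventually.of_forall hpt)).trans ?_
  rw [show (1 + 2 * B) * B * ε = ε * (1 + 2 * B) * B by ring]
  gcongr
  exact hm.real_univ_le

/-- One explicit Euler step, of length `h`, for the coagulation-fragmentation dynamics with
coagulation rate `a` and fragmentation rate `b`. -/
def eulerStep (a : ℝ → ℝ → ℝ) (b : ℝ → ℝ) (h : ℝ) (f : Measure ℝ) : Measure ℝ :=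
  f.withDensity (fun x => ENNReal.ofReal (1 - h * ((∫ y, a x y ∂f) + b x / 4))) +
    ENNReal.ofReal (h / 2) •
      ((f.prod f).withDensity fun p => ENNReal.ofReal (a p.1 p.2)).map (fun p => p.1 + p.2) +
    ENNReal.ofReal (h / 2) • (f.withDensity fun x => ENNReal.ofReal (b x)).map fun x => x / 2

/-- Measurable coagulation and fragmentation rates with values in `[0, A]`. -/
structure BoundedRates (a : ℝ → ℝ → ℝ) (b : ℝ → ℝ) (A : ℝ) : Prop where
  meas_coag : Measurable (Function.uncurry a)
  meas_frag : Measurable b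
  coag_nonneg : ∀ x y, 0 ≤ a x y
  coag_le : ∀ x y, a x y ≤ A
  coag_symm : ∀ x y, a x y = a y x
  frag_nonneg : ∀ x, 0 ≤ b x
  frag_le : ∀ x, b x ≤ A

namespace BoundedRates

variable {a : ℝ → ℝ → ℝ} {b : ℝ → ℝ} {A h : ℝ} {f : Measure ℝ}

lemma nonneg (H : BoundedRates a b A) : 0 ≤ A := (H.frag_nonneg 0).trans (H.frag_le 0)

lemma integral_coag_nonneg (H : BoundedRates a b A) (x : ℝ) : 0 ≤ ∫ y, a x y ∂f :=
  integral_nonneg (H.coag_nonneg x)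

variable [IsFiniteMeasure f]

lemma integrable_coag (H : BoundedRates a b A) (x : ℝ) : Integrable (a x) f :=
  Integrable.of_bound (H.meas_coag.comp measurable_prodMk_left).aestronglyMeasurable A
    (Eventually.of_forall fun y => by
      rw [Real.norm_eq_abs, abs_of_nonneg (H.coag_nonneg x y)]
      exact H.coag_le x y)

lemma measurable_integral_coag (H : BoundedRates a b A) : Measurable fun x => ∫ y, a x y ∂f :=
  (H.meas_coag.stronglyMeasurable.integral_prod_right (ν := f)).measurable

lemma integral_coag_le (H : BoundedRates a b A) (x : ℝ) : ∫ y, a x y ∂f ≤ A * f.real Set.univ := by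
  refine (integral_mono (H.integrable_coag x) (integrable_const A) (H.coag_le x)).trans ?_
  simp [mul_comm]

lemma survival_nonneg (H : BoundedRates a b A) (hh : 0 ≤ h)
    (hA : h * (A * f.real Set.univ + A) ≤ 1) (x : ℝ) :
    0 ≤ 1 - h * ((∫ y, a x y ∂f) + b x / 4) := by
  have h1 := H.integral_coag_le (f := f) x
  have h2 := H.frag_le x
  have h3 := H.nonneg
  have : h * ((∫ y, a x y ∂f) + b x / 4) ≤ h * (A * f.real Set.univ + A) := by
    gcongr; linarith
  linarith

lemma measurable_survival (H : BoundedRates a b A) :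
    Measurable fun x => 1 - h * ((∫ y, a x y ∂f) + b x / 4) :=
  measurable_const.sub ((H.measurable_integral_coag.add (H.meas_frag.div_const 4)).const_mul h)

lemma lintegral_eulerStep (H : BoundedRates a b A) {φ : ℝ → ENNReal} (hφ : Measurable φ) :
    ∫⁻ x, φ x ∂(eulerStep a b h f) =
      (∫⁻ x, ENNReal.ofReal (1 - h * ((∫ y, a x y ∂f) + b x / 4)) * φ x ∂f) +
      ENNReal.ofReal (h / 2) * (∫⁻ x, ∫⁻ y, ENNReal.ofReal (a x y) * φ (x + y) ∂f ∂f) +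
      ENNReal.ofReal (h / 2) * ∫⁻ x, ENNReal.ofReal (b x) * φ (x / 2) ∂f := by
  have hadd : Measurable fun p : ℝ × ℝ => p.1 + p.2 := by fun_prop
  have ha : Measurable fun p : ℝ × ℝ => ENNReal.ofReal (a p.1 p.2) := H.meas_coag.ennreal_ofReal
  have hφ1 : Measurable fun p : ℝ × ℝ => φ (p.1 + p.2) := hφ.comp hadd
  have hφ2 : Measurable fun x : ℝ => φ (x / 2) := hφ.comp (by fun_prop)
  rw [eulerStep, lintegral_add_measure, lintegral_add_measure, lintegral_smul_measure,
    lintegral_smul_measure, lintegral_map hφ hadd, lintegral_map hφ (by fun_prop),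
    lintegral_withDensity_eq_lintegral_mul _ H.measurable_survival.ennreal_ofReal hφ,
    lintegral_withDensity_eq_lintegral_mul _ ha hφ1,
    lintegral_withDensity_eq_lintegral_mul _ H.meas_frag.ennreal_ofReal hφ2,
    lintegral_prod _ (ha.mul hφ1).aemeasurable]
  rfl

lemma lintegral_eulerStep_le (H : BoundedRates a b A) (hh : 0 ≤ h)
    (hA : h * (A * f.real Set.univ + A) ≤ 1) {φ : ℝ → ENNReal} (hφ : Measurable φ)
    {D : ℝ → ℝ → ENNReal} {E : ℝ → ENNReal} (hE : Measurable E)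
    (haD : ∀ x y, ENNReal.ofReal (a x y) * φ (x + y) ≤
      ENNReal.ofReal (a x y) * φ x + ENNReal.ofReal (a x y) * φ y + D x y)
    (hbE : ∀ x, ENNReal.ofReal (b x) * (2 * φ (x / 2)) ≤ ENNReal.ofReal (b x) * φ x + E x) :
    ∫⁻ x, φ x ∂(eulerStep a b h f) ≤ (∫⁻ x, φ x ∂f) +
      ENNReal.ofReal (h / 2) * (∫⁻ x, ∫⁻ y, D x y ∂f ∂f) +
      ENNReal.ofReal (h / 4) * ∫⁻ x, E x ∂f := by
  have ha : Measurable (Function.uncurry fun x y => ENNReal.ofReal (a x y)) :=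
    H.meas_coag.ennreal_ofReal
  have hax : ∀ x, Measurable fun y => ENNReal.ofReal (a x y) := fun x =>
    ha.comp measurable_prodMk_left
  have hL : ∀ x, ∫⁻ y, ENNReal.ofReal (a x y) ∂f = ENNReal.ofReal (∫ y, a x y ∂f) := fun x =>
    (ofReal_integral_eq_lintegral_ofReal (H.integrable_coag x)
      (Eventually.of_forall (H.coag_nonneg x))).symm
  have hLm : Measurable fun x => ENNReal.ofReal (∫ y, a x y ∂f) * φ x :=
    H.measurable_integral_coag.ennreal_ofReal.mul hφ
  have e1 : ∫⁻ x, ∫⁻ y, ENNReal.ofReal (a x y) * φ x ∂f ∂f =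
      ∫⁻ x, ENNReal.ofReal (∫ y, a x y ∂f) * φ x ∂f :=
    lintegral_congr fun x => by rw [lintegral_mul_const _ (hax x), hL]
  have e2 : ∫⁻ x, ∫⁻ y, ENNReal.ofReal (a x y) * φ y ∂f ∂f =
      ∫⁻ x, ENNReal.ofReal (∫ y, a x y ∂f) * φ x ∂f := by
    rw [lintegral_lintegral_swap (ha.mul (hφ.comp measurable_snd)).aemeasurable, ← e1]
    simp only [H.coag_symm]
  have hcoag : ∫⁻ x, ∫⁻ y, ENNReal.ofReal (a x y) * φ (x + y) ∂f ∂f ≤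
      2 * (∫⁻ x, ENNReal.ofReal (∫ y, a x y ∂f) * φ x ∂f) + ∫⁻ x, ∫⁻ y, D x y ∂f ∂f := by
    calc _ ≤ ∫⁻ x, ∫⁻ y, (ENNReal.ofReal (a x y) * φ x + ENNReal.ofReal (a x y) * φ y + D x y)
            ∂f ∂f := lintegral_mono fun x => lintegral_mono fun y => haD x y
      _ = ∫⁻ x, ((∫⁻ y, ENNReal.ofReal (a x y) * φ x ∂f) +
            (∫⁻ y, ENNReal.ofReal (a x y) * φ y ∂f) + ∫⁻ y, D x y ∂f) ∂f :=
          lintegral_congr fun x => by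
            have m1 : Measurable fun y => ENNReal.ofReal (a x y) * φ x := (hax x).mul_const _
            have m2 : Measurable fun y =>
              ENNReal.ofReal (a x y) * φ x + ENNReal.ofReal (a x y) * φ y :=
              m1.add ((hax x).mul hφ)
            rw [lintegral_add_left m2, lintegral_add_left m1]
      _ = _ := by
          have m1 : Measurable fun x => ∫⁻ y, ENNReal.ofReal (a x y) * φ x ∂f :=
            (ha.mul (hφ.comp measurable_fst)).lintegral_prod_right'
          have m2 : Measurable fun x => ∫⁻ y, ENNReal.ofReal (a x y) * φ y ∂f :=
            (ha.mul (hφ.comp measurable_snd)).lintegral_prod_right'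
          have m3 : Measurable fun x => (∫⁻ y, ENNReal.ofReal (a x y) * φ x ∂f) +
            ∫⁻ y, ENNReal.ofReal (a x y) * φ y ∂f := m1.add m2
          rw [lintegral_add_left m3, lintegral_add_left m1, e1, e2, two_mul]
  have hfrag : 2 * (∫⁻ x, ENNReal.ofReal (b x) * φ (x / 2) ∂f) ≤
      (∫⁻ x, ENNReal.ofReal (b x) * φ x ∂f) + ∫⁻ x, E x ∂f := by
    have m1 : Measurable fun x => ENNReal.ofReal (b x) * φ (x / 2) :=
      H.meas_frag.ennreal_ofReal.mul (hφ.comp (by fun_prop : Measurable fun x : ℝ => x / 2))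
    rw [← lintegral_const_mul _ m1, ← lintegral_add_right _ hE]
    refine lintegral_mono fun x => ?_
    rw [mul_left_comm]
    exact hbE x
  have h2 : ENNReal.ofReal (h / 2) * 2 = ENNReal.ofReal h := by
    rw [show (2 : ENNReal) = ENNReal.ofReal 2 by simp, ← ENNReal.ofReal_mul (by positivity)]
    congr 1; ring
  have h4 : ENNReal.ofReal (h / 2) = ENNReal.ofReal (h / 4) * 2 := by
    rw [show (2 : ENNReal) = ENNReal.ofReal 2 by simp, ← ENNReal.ofReal_mul (by positivity)]
    congr 1; ring
  have hsum : (∫⁻ x, ENNReal.ofReal (1 - h * ((∫ y, a x y ∂f) + b x / 4)) * φ x ∂f) +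
      ENNReal.ofReal h * (∫⁻ x, ENNReal.ofReal (∫ y, a x y ∂f) * φ x ∂f) +
      ENNReal.ofReal (h / 4) * (∫⁻ x, ENNReal.ofReal (b x) * φ x ∂f) = ∫⁻ x, φ x ∂f := by
    have m1 : Measurable fun x => ENNReal.ofReal (b x) * φ x := H.meas_frag.ennreal_ofReal.mul hφ
    rw [← lintegral_const_mul _ hLm, ← lintegral_const_mul _ m1,
      ← lintegral_add_right _ (hLm.const_mul _), ← lintegral_add_right _ (m1.const_mul _)]
    refine lintegral_congr fun x => ?_
    have n1 := H.survival_nonneg hh hA x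
    have n2 := H.integral_coag_nonneg (f := f) x
    have n3 := H.frag_nonneg x
    rw [← mul_assoc, ← mul_assoc, ← add_mul, ← add_mul, ← ENNReal.ofReal_mul hh,
      ← ENNReal.ofReal_mul (by positivity), ← ENNReal.ofReal_add n1 (by positivity),
      ← ENNReal.ofReal_add (by positivity) (by positivity),
      show 1 - h * ((∫ y, a x y ∂f) + b x / 4) + h * (∫ y, a x y ∂f) + h / 4 * b x = 1 by ring,
      ENNReal.ofReal_one, one_mul]
  rw [H.lintegral_eulerStep hφ, ← hsum]
  calc _ ≤ (∫⁻ x, ENNReal.ofReal (1 - h * ((∫ y, a x y ∂f) + b x / 4)) * φ x ∂f) +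
        ENNReal.ofReal (h / 2) * (2 * (∫⁻ x, ENNReal.ofReal (∫ y, a x y ∂f) * φ x ∂f) +
          ∫⁻ x, ∫⁻ y, D x y ∂f ∂f) +
        ENNReal.ofReal (h / 4) * ((∫⁻ x, ENNReal.ofReal (b x) * φ x ∂f) + ∫⁻ x, E x ∂f) := by
        refine add_le_add (add_le_add le_rfl (mul_le_mul' le_rfl hcoag)) ?_
        rw [h4, mul_assoc]
        exact mul_le_mul' le_rfl hfrag
    _ = _ := by
        rw [mul_add, ← mul_assoc, h2]
        ring

lemma integral_eulerStep (H : BoundedRates a b A) (hh : 0 ≤ h)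
    (hA : h * (A * f.real Set.univ + A) ≤ 1) {φ : ℝ → ℝ} (hφ : Continuous φ)
    (hi : Integrable φ f) (hi2 : Integrable (fun x => φ (x / 2)) f)
    (hia : Integrable (fun p : ℝ × ℝ => φ (p.1 + p.2)) (f.prod f)) :
    (∫ x, φ x ∂(eulerStep a b h f)) - ∫ x, φ x ∂f =
      h * (1 / 2 * (∫ x, ∫ y, a x y * (φ (x + y) - φ x - φ y) ∂f ∂f) -
        1 / 4 * ∫ x, b x * (φ x - 2 * φ (x / 2)) ∂f) := by
  have hadd : Measurable fun p : ℝ × ℝ => p.1 + p.2 := by fun_prop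
  have hhalf : Measurable fun x : ℝ => x / 2 := by fun_prop
  have ha : Measurable fun p : ℝ × ℝ => a p.1 p.2 := H.meas_coag
  have hs := H.measurable_survival (f := f) (h := h)
  have hbdd : ∀ {X : Type} [MeasurableSpace X] {m : Measure X} {r g : X → ℝ}, Measurable r →
      (∀ x, 0 ≤ r x) → (∃ c, ∀ x, r x ≤ c) → Integrable g m → Integrable (fun x => r x * g x) m := by
    rintro X _ m r g hr h0 ⟨c, hc⟩ hg
    exact hg.bdd_mul (c := c) hr.aestronglyMeasurable (Eventually.of_forall fun x => by
      rw [Real.norm_eq_abs, abs_of_nonneg (h0 x)]; exact hc x)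
  have d1 : ∀ {X : Type} [MeasurableSpace X] (m : Measure X) {r g : X → ℝ}, Measurable r →
      (∀ x, 0 ≤ r x) →
      ∫ x, g x ∂(m.withDensity fun x => ENNReal.ofReal (r x)) = ∫ x, r x * g x ∂m := by
    intro X _ m r g hr h0
    rw [integral_withDensity_eq_integral_toReal_smul hr.ennreal_ofReal
      (Eventually.of_forall fun _ => ENNReal.ofReal_lt_top)]
    exact integral_congr_ae (Eventually.of_forall fun x => by
      simp [ENNReal.toReal_ofReal (h0 x)])
  have d2 : ∀ {X : Type} [MeasurableSpace X] (m : Measure X) {r g : X → ℝ}, Measurable r →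
      (∀ x, 0 ≤ r x) → Integrable (fun x => r x * g x) m →
      Integrable g (m.withDensity fun x => ENNReal.ofReal (r x)) := by
    intro X _ m r g hr h0 hg
    rw [integrable_withDensity_iff_integrable_smul' hr.ennreal_ofReal
      (Eventually.of_forall fun _ => ENNReal.ofReal_lt_top)]
    exact hg.congr (Eventually.of_forall fun x => by simp [ENNReal.toReal_ofReal (h0 x)])
  have hsle : ∀ x, 1 - h * ((∫ y, a x y ∂f) + b x / 4) ≤ 1 := fun x => by
    have n2 := H.integral_coag_nonneg (f := f) x
    have n3 := H.frag_nonneg x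
    have : 0 ≤ h * ((∫ y, a x y ∂f) + b x / 4) := by positivity
    linarith
  have ha0 : ∀ p : ℝ × ℝ, 0 ≤ a p.1 p.2 := fun p => H.coag_nonneg _ _
  have haA : ∃ c, ∀ p : ℝ × ℝ, a p.1 p.2 ≤ c := ⟨A, fun p => H.coag_le _ _⟩
  have iS := hbdd hs (H.survival_nonneg hh hA) ⟨1, hsle⟩ hi
  have iA := hbdd ha ha0 haA hia
  have iB := hbdd H.meas_frag H.frag_nonneg ⟨A, H.frag_le⟩ hi2
  have iA1 := hbdd ha ha0 haA (hi.comp_fst f)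
  have iA2 := hbdd ha ha0 haA (hi.comp_snd f)
  have iB1 := hbdd H.meas_frag H.frag_nonneg ⟨A, H.frag_le⟩ hi
  have iL := hbdd H.measurable_integral_coag H.integral_coag_nonneg
    ⟨_, H.integral_coag_le (f := f)⟩ hi
  have sA1 : ∫ p, a p.1 p.2 * φ p.1 ∂(f.prod f) = ∫ x, (∫ y, a x y ∂f) * φ x ∂f := by
    rw [integral_prod _ iA1]
    simp only [integral_mul_const]
  have sA2 : ∫ p, a p.1 p.2 * φ p.2 ∂(f.prod f) = ∫ x, (∫ y, a x y ∂f) * φ x ∂f := by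
    rw [integral_prod_symm _ iA2]
    simp only [integral_mul_const]
    simp only [fun x y => H.coag_symm x y]
  have sA : ∫ x, ∫ y, a x y * (φ (x + y) - φ x - φ y) ∂f ∂f =
      (∫ p, a p.1 p.2 * φ (p.1 + p.2) ∂(f.prod f)) - 2 * ∫ x, (∫ y, a x y ∂f) * φ x ∂f := by
    have i3 : Integrable (fun p : ℝ × ℝ => a p.1 p.2 * (φ (p.1 + p.2) - φ p.1 - φ p.2))
        (f.prod f) := ((iA.sub iA1).sub iA2).congr (Eventually.of_forall fun p => by
          simp only [Pi.sub_apply]; ring)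
    have i4 : Integrable (fun p : ℝ × ℝ => a p.1 p.2 * φ (p.1 + p.2) - a p.1 p.2 * φ p.1)
        (f.prod f) := iA.sub iA1
    rw [← integral_prod _ i3, two_mul, ← sub_sub]
    nth_rewrite 1 [← sA1]
    rw [← sA2, ← integral_sub iA iA1, ← integral_sub i4 iA2]
    exact integral_congr_ae (Eventually.of_forall fun p => by simp only; ring)
  have sB : ∫ x, b x * (φ x - 2 * φ (x / 2)) ∂f =
      (∫ x, b x * φ x ∂f) - 2 * ∫ x, b x * φ (x / 2) ∂f := by
    rw [← integral_const_mul, ← integral_sub iB1 (iB.const_mul 2)]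
    exact integral_congr_ae (Eventually.of_forall fun p => by simp only; ring)
  have sS : ∫ x, (1 - h * ((∫ y, a x y ∂f) + b x / 4)) * φ x ∂f =
      (∫ x, φ x ∂f) - h * (∫ x, (∫ y, a x y ∂f) * φ x ∂f) - h / 4 * ∫ x, b x * φ x ∂f := by
    have i4 : Integrable (fun x => φ x - h * ((∫ y, a x y ∂f) * φ x)) f := hi.sub (iL.const_mul h)
    rw [← integral_const_mul, ← integral_const_mul, ← integral_sub hi (iL.const_mul h),
      ← integral_sub i4 (iB1.const_mul _)]
    exact integral_congr_ae (Eventually.of_forall fun p => by simp only; ring)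
  have j2 : Integrable φ (((f.prod f).withDensity fun p => ENNReal.ofReal (a p.1 p.2)).map
      fun p => p.1 + p.2) :=
    (integrable_map_measure hφ.aestronglyMeasurable hadd.aemeasurable).2 (d2 _ ha ha0 iA)
  have j3 : Integrable φ ((f.withDensity fun x => ENNReal.ofReal (b x)).map fun x => x / 2) :=
    (integrable_map_measure hφ.aestronglyMeasurable hhalf.aemeasurable).2
      (d2 _ H.meas_frag H.frag_nonneg iB)
  have j1 := d2 _ hs (H.survival_nonneg hh hA) iS
  rw [eulerStep, integral_add_measure (j1.add_measure (j2.smul_measure ENNReal.ofReal_ne_top))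
      (j3.smul_measure ENNReal.ofReal_ne_top),
    integral_add_measure j1 (j2.smul_measure ENNReal.ofReal_ne_top), integral_smul_measure,
    integral_smul_measure, ENNReal.toReal_ofReal (by positivity),
    integral_map hadd.aemeasurable hφ.aestronglyMeasurable,
    integral_map hhalf.aemeasurable hφ.aestronglyMeasurable, d1 _ hs (H.survival_nonneg hh hA),
    d1 _ ha ha0, d1 _ H.meas_frag H.frag_nonneg, sS, sA, sB]
  simp only [smul_eq_mul]
  ring

end BoundedRates

/-- Growth, support and regularity conditions on a coagulation kernel `κ` and a fragmentation
rate `g`. -/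
structure Rates (κ : ℝ → ℝ → ℝ) (g : ℝ → ℝ) (C p θ : ℝ) : Prop where
  const_nonneg : 0 ≤ C
  one_le : 1 ≤ p
  lt : p + 1 < θ
  meas_coag : Measurable (Function.uncurry κ)
  cont_coag : ContinuousOn (Function.uncurry κ) (Set.Ioi 0 ×ˢ Set.Ioi 0)
  coag_nonneg : ∀ x y, 0 ≤ κ x y
  coag_symm : ∀ x y, κ x y = κ y x
  coag_supp : ∀ x y, κ x y ≠ 0 → 0 < x ∧ x ≤ 2 * y ∧ y ≤ 2 * x
  coag_le : ∀ x y, 0 < x → κ x y ≤ C * (x⁻¹ + x)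
  cont_frag : Continuous g
  frag_nonneg : ∀ x, 0 ≤ g x
  frag_le : ∀ x, g x ≤ C * (1 + |x| ^ p)
  frag_le_of_le : ∀ x, x ≤ 2 → g x ≤ C

namespace Rates

variable {κ : ℝ → ℝ → ℝ} {g : ℝ → ℝ} {C p θ N B h m : ℝ} {f : Measure ℝ}

lemma two_lt (H : Rates κ g C p θ) : 2 < θ := by linarith [H.one_le, H.lt]

lemma bounded (H : Rates κ g C p θ) (hN : 0 ≤ N) :
    BoundedRates (fun x y => min (κ x y) N) (fun x => min (g x) N) N where
  meas_coag := H.meas_coag.min measurable_const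
  meas_frag := H.cont_frag.measurable.min measurable_const
  coag_nonneg x y := le_min (H.coag_nonneg x y) hN
  coag_le x y := min_le_right _ _
  coag_symm x y := by rw [H.coag_symm]
  frag_nonneg x := le_min (H.frag_nonneg x) hN
  frag_le x := min_le_right _ _

lemma frag_le_weight (H : Rates κ g C p θ) (x : ℝ) : g x ≤ 2 * C * momentWeight θ x := by
  have h1 := rpow_le_momentWeight (by linarith [H.one_le]) (by linarith [H.lt] : p ≤ θ) x
  have h2 := one_le_momentWeight θ x
  have h3 := H.const_nonneg
  calc g x ≤ C * (1 + |x| ^ p) := H.frag_le x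
    _ ≤ C * (momentWeight θ x + momentWeight θ x) := by gcongr
    _ = _ := by ring

lemma coag_mul_weight_le (H : Rates κ g C p θ) (hN : 0 ≤ N) (x y : ℝ) :
    min (κ x y) N * momentWeight θ (x + y) ≤ min (κ x y) N * momentWeight θ x +
      min (κ x y) N * momentWeight θ y + 4 * C * 3 ^ θ * momentWeight θ x * |y| := by
  have hC := H.const_nonneg
  have hθ := H.two_lt
  have w0 := momentWeight_pos θ x
  have w1 := momentWeight_pos θ y
  have m0 : 0 ≤ min (κ x y) N := le_min (H.coag_nonneg x y) hN
  by_cases hk : κ x y = 0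
  · rw [hk, min_eq_left hN]
    have : 0 ≤ 4 * C * 3 ^ θ * momentWeight θ x * |y| := by positivity
    simpa using this
  obtain ⟨hx, hxy, hyx⟩ := H.coag_supp x y hk
  have hy : 0 < y := by linarith
  have key : min (κ x y) N * (x + y) ^ θ ≤ 4 * C * 3 ^ θ * momentWeight θ x * y := by
    have e1 : (x + y) ^ θ ≤ 3 ^ θ * x ^ θ := by
      rw [← Real.mul_rpow (by norm_num) hx.le]
      exact Real.rpow_le_rpow (by positivity) (by linarith) (by linarith)
    have e2 : x ^ θ = x ^ (θ - 2) * x * x := by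
      rw [mul_assoc, ← pow_two, ← Real.rpow_natCast x 2, ← Real.rpow_add hx]
      norm_num
    have e3 : x ^ (θ - 2) ≤ momentWeight θ x := by
      have := rpow_le_momentWeight (by linarith : 0 ≤ θ - 2) (by linarith : θ - 2 ≤ θ) x
      rwa [abs_of_pos hx] at this
    have e4 : x ^ θ ≤ momentWeight θ x := by
      have := rpow_le_momentWeight (by linarith : 0 ≤ θ) le_rfl x
      rwa [abs_of_pos hx] at this
    have e5 : (x⁻¹ + x) * x ^ θ = x * (x ^ (θ - 2) + x ^ θ) := by
      rw [e2]; field_simp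
    calc min (κ x y) N * (x + y) ^ θ ≤ (C * (x⁻¹ + x)) * (3 ^ θ * x ^ θ) := by
          gcongr
          exact (min_le_left _ _).trans (H.coag_le x y hx)
      _ = C * 3 ^ θ * (x * (x ^ (θ - 2) + x ^ θ)) := by rw [← e5]; ring
      _ ≤ C * 3 ^ θ * ((2 * y) * (momentWeight θ x + momentWeight θ x)) := by gcongr
      _ = _ := by ring
  have : momentWeight θ (x + y) = 1 + (x + y) ^ θ := by
    unfold momentWeight; rw [abs_of_pos (by linarith)]
  rw [this, abs_of_pos hy, mul_add, mul_one]
  have h2 := one_le_momentWeight θ x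
  nlinarith [mul_nonneg m0 w1.le]

lemma frag_mul_weight_le (H : Rates κ g C p θ) (hN : 0 ≤ N) (x : ℝ) :
    min (g x) N * (2 * momentWeight θ (x / 2)) ≤
      min (g x) N * momentWeight θ x + min (g x) N := by
  have hθ := H.two_lt
  have m0 : 0 ≤ min (g x) N := le_min (H.frag_nonneg x) hN
  have e : 2 * momentWeight θ (x / 2) ≤ momentWeight θ x + 1 := by
    unfold momentWeight
    rw [abs_div, Real.div_rpow (abs_nonneg x) (abs_nonneg _), abs_two]
    have h2 : (2 : ℝ) ≤ 2 ^ θ := by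
      simpa using Real.rpow_le_rpow_of_exponent_le one_le_two (by linarith : 1 ≤ θ)
    have h3 : 0 ≤ |x| ^ θ := by positivity
    have : |x| ^ θ / 2 ^ θ ≤ |x| ^ θ / 2 := by gcongr
    linarith
  calc _ ≤ min (g x) N * (momentWeight θ x + 1) := by gcongr
    _ = _ := by ring

lemma lintegral_frag_le (H : Rates κ g C p θ) (hf : SizeBound θ B f) :
    ∫⁻ x, ENNReal.ofReal (min (g x) N) ∂f ≤ ENNReal.ofReal (2 * C * B) := by
  have hC := H.const_nonneg
  calc _ ≤ ∫⁻ x, ENNReal.ofReal (2 * C) * ENNReal.ofReal (momentWeight θ x) ∂f := by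
        refine lintegral_mono fun x => ?_
        rw [← ENNReal.ofReal_mul (by positivity)]
        exact ENNReal.ofReal_le_ofReal ((min_le_left _ _).trans (H.frag_le_weight x))
    _ = ENNReal.ofReal (2 * C) * ∫⁻ x, ENNReal.ofReal (momentWeight θ x) ∂f :=
        lintegral_const_mul _
          (continuous_momentWeight (by linarith [H.two_lt])).measurable.ennreal_ofReal
    _ ≤ ENNReal.ofReal (2 * C) * ENNReal.ofReal B := by gcongr; exact hf.mom
    _ = _ := by rw [← ENNReal.ofReal_mul (by positivity)]

lemma lintegral_abs_eulerStep_le (H : Rates κ g C p θ) (hN : 0 ≤ N) (hh : 0 ≤ h)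
    [IsFiniteMeasure f] (hA : h * (N * f.real Set.univ + N) ≤ 1) :
    ∫⁻ x, ENNReal.ofReal |x| ∂(eulerStep (fun x y => min (κ x y) N) (fun x => min (g x) N) h f)
      ≤ ∫⁻ x, ENNReal.ofReal |x| ∂f := by
  have := (H.bounded hN).lintegral_eulerStep_le hh hA (φ := fun x => ENNReal.ofReal |x|)
    (D := fun _ _ => 0) (E := fun _ => 0) (by fun_prop) measurable_const
    (fun x y => by
      rw [add_zero, ← mul_add, ← ENNReal.ofReal_add (abs_nonneg _) (abs_nonneg _)]
      gcongr
      exact abs_add_le x y)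
    (fun x => by
      rw [add_zero, ← ENNReal.ofReal_ofNat, ← ENNReal.ofReal_mul zero_le_two, abs_div, abs_two,
        mul_div_cancel₀ _ two_ne_zero])
  simpa using this

/-- One Euler step increases the size bound by a factor `1 + O(h)`, with a constant depending on
the measure only through its first moment. -/
lemma sizeBound_eulerStep (H : Rates κ g C p θ) (hN : 0 ≤ N) (hh : 0 ≤ h) (hm : 0 ≤ m)
    (hf : SizeBound θ B f) (hfm : ∫⁻ x, ENNReal.ofReal |x| ∂f ≤ ENNReal.ofReal m)
    (hA : h * (N * f.real Set.univ + N) ≤ 1) :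
    SizeBound θ (B * (1 + C * (2 * 3 ^ θ * m + 1) * h))
      (eulerStep (fun x y => min (κ x y) N) (fun x => min (g x) N) h f) := by
  have hC := H.const_nonneg
  have hB := hf.nonneg
  have hθ := H.two_lt
  have := hf.isFiniteMeasure
  have hw : Measurable fun x => ENNReal.ofReal (momentWeight θ x) :=
    (continuous_momentWeight (by linarith)).measurable.ennreal_ofReal
  have hgm : Measurable fun x => ENNReal.ofReal (min (g x) N) :=
    (H.bounded hN).meas_frag.ennreal_ofReal
  have a0 : ∀ x y, 0 ≤ min (κ x y) N := (H.bounded hN).coag_nonneg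
  have b0 : ∀ x, 0 ≤ min (g x) N := (H.bounded hN).frag_nonneg
  have w0 : ∀ x, 0 ≤ momentWeight θ x := fun x => (momentWeight_pos θ x).le
  refine ⟨by positivity, ?_, fun R hR => ?_⟩
  · refine ((H.bounded hN).lintegral_eulerStep_le hh hA hw
      (D := fun x y => ENNReal.ofReal (4 * C * 3 ^ θ * momentWeight θ x * |y|))
      (E := fun x => ENNReal.ofReal (min (g x) N)) hgm (fun x y => ?_) (fun x => ?_)).trans ?_
    · have w1 := w0 x
      rw [← ENNReal.ofReal_mul (a0 x y), ← ENNReal.ofReal_mul (a0 x y),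
        ← ENNReal.ofReal_mul (a0 x y),
        ← ENNReal.ofReal_add (mul_nonneg (a0 x y) (w0 x)) (mul_nonneg (a0 x y) (w0 y)),
        ← ENNReal.ofReal_add (add_nonneg (mul_nonneg (a0 x y) (w0 x))
          (mul_nonneg (a0 x y) (w0 y))) (by positivity)]
      exact ENNReal.ofReal_le_ofReal (H.coag_mul_weight_le hN x y)
    · rw [← ENNReal.ofReal_ofNat, ← ENNReal.ofReal_mul zero_le_two, ← ENNReal.ofReal_mul (b0 x),
        ← ENNReal.ofReal_mul (b0 x), ← ENNReal.ofReal_add (mul_nonneg (b0 x) (w0 x)) (b0 x)]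
      exact ENNReal.ofReal_le_ofReal (H.frag_mul_weight_le hN x)
    have hD : ∫⁻ x, ∫⁻ y, ENNReal.ofReal (4 * C * 3 ^ θ * momentWeight θ x * |y|) ∂f ∂f ≤
        ENNReal.ofReal (4 * C * 3 ^ θ * B * m) := by
      calc _ = ∫⁻ x, ENNReal.ofReal (4 * C * 3 ^ θ) * ENNReal.ofReal (momentWeight θ x) *
              ∫⁻ y, ENNReal.ofReal |y| ∂f ∂f := by
            refine lintegral_congr fun x => ?_
            rw [← lintegral_const_mul _ (by fun_prop)]
            refine lintegral_congr fun y => ?_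
            have w1 := w0 x
            rw [ENNReal.ofReal_mul (by positivity), ENNReal.ofReal_mul (by positivity)]
        _ = ENNReal.ofReal (4 * C * 3 ^ θ) * (∫⁻ x, ENNReal.ofReal (momentWeight θ x) ∂f) *
              ∫⁻ y, ENNReal.ofReal |y| ∂f := by
            rw [lintegral_mul_const _ (hw.const_mul _), lintegral_const_mul _ hw]
        _ ≤ ENNReal.ofReal (4 * C * 3 ^ θ) * ENNReal.ofReal B * ENNReal.ofReal m := by
            gcongr; exact hf.mom
        _ = _ := by
            rw [← ENNReal.ofReal_mul (by positivity), ← ENNReal.ofReal_mul (by positivity)]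
    calc _ ≤ ENNReal.ofReal B + ENNReal.ofReal (h / 2) * ENNReal.ofReal (4 * C * 3 ^ θ * B * m) +
          ENNReal.ofReal (h / 4) * ENNReal.ofReal (2 * C * B) := by
          gcongr
          · exact hf.mom
          · exact H.lintegral_frag_le hf
      _ = ENNReal.ofReal (B + h / 2 * (4 * C * 3 ^ θ * B * m) + h / 4 * (2 * C * B)) := by
          rw [← ENNReal.ofReal_mul (by positivity), ← ENNReal.ofReal_mul (by positivity),
            ← ENNReal.ofReal_add (by positivity) (by positivity),
            ← ENNReal.ofReal_add (by positivity) (by positivity)]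
      _ ≤ _ := by
          refine ENNReal.ofReal_le_ofReal ?_
          have : 0 ≤ C * B * h := by positivity
          linarith
  · have hI : Measurable ((Set.Iic R).indicator (1 : ℝ → ENNReal)) :=
      measurable_one.indicator measurableSet_Iic
    have hE : Measurable ((Set.Iic (2 * R)).indicator
        fun x => 2 * ENNReal.ofReal (min (g x) N)) :=
      (hgm.const_mul 2).indicator measurableSet_Iic
    have key := (H.bounded hN).lintegral_eulerStep_le hh hA hI (D := fun _ _ => 0) hE
      (fun x y => ?_) (fun x => ?_)
    · rw [lintegral_indicator_one measurableSet_Iic, lintegral_indicator_one measurableSet_Iic,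
        lintegral_indicator measurableSet_Iic] at key
      refine key.trans ?_
      have hE2 : ∫⁻ x in Set.Iic (2 * R), 2 * ENNReal.ofReal (min (g x) N) ∂f ≤
          ENNReal.ofReal (4 * C * B * R) := by
        rw [lintegral_const_mul _ hgm]
        rcases le_total R 1 with hR1 | hR1
        · calc _ ≤ 2 * ∫⁻ x in Set.Iic (2 * R), ENNReal.ofReal C ∂f := by
                gcongr 2 * ?_
                refine setLIntegral_mono measurable_const fun x hx => ?_
                refine ENNReal.ofReal_le_ofReal ((min_le_left _ _).trans (H.frag_le_of_le x ?_))
                exact (Set.mem_Iic.1 hx).trans (by linarith)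
            _ ≤ 2 * (ENNReal.ofReal C * ENNReal.ofReal (B * (2 * R))) := by
                rw [setLIntegral_const]
                gcongr
                exact hf.small _ (by positivity)
            _ = ENNReal.ofReal (2 * (C * (B * (2 * R)))) := by
                rw [ENNReal.ofReal_mul zero_le_two, ENNReal.ofReal_mul hC, ENNReal.ofReal_ofNat]
            _ = _ := by congr 1; ring
        · calc _ ≤ 2 * ENNReal.ofReal (2 * C * B) := by
                gcongr
                exact (setLIntegral_le_lintegral _ _).trans (H.lintegral_frag_le hf)
            _ = ENNReal.ofReal (4 * C * B) := by
                rw [← ENNReal.ofReal_ofNat, ← ENNReal.ofReal_mul zero_le_two]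
                congr 1; ring
            _ ≤ _ := ENNReal.ofReal_le_ofReal (le_mul_of_one_le_right (by positivity) hR1)
      calc _ ≤ ENNReal.ofReal (B * R) + ENNReal.ofReal (h / 4) * ENNReal.ofReal (4 * C * B * R) := by
            simp only [lintegral_zero, mul_zero, add_zero]
            gcongr
            exact hf.small R hR
        _ = ENNReal.ofReal (B * R + h / 4 * (4 * C * B * R)) := by
            rw [← ENNReal.ofReal_mul (by positivity),
              ← ENNReal.ofReal_add (by positivity) (by positivity)]
        _ ≤ _ := by
            refine ENNReal.ofReal_le_ofReal ?_
            have : 0 ≤ C * B * R * h * (3 ^ θ * m) := by positivity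
            linarith
    · by_cases hk : κ x y = 0
      · simp [hk, hN]
      obtain ⟨hx, hxy, hyx⟩ := H.coag_supp x y hk
      by_cases hR' : x + y ≤ R
      · have h1 : x ≤ R := by linarith
        simp [Set.indicator, hR', h1]
      · simp [Set.indicator, hR']
    · by_cases hx : x / 2 ≤ R
      · have h1 : x ≤ 2 * R := by linarith
        rw [Set.indicator_of_mem (Set.mem_Iic.2 hx), Set.indicator_of_mem (Set.mem_Iic.2 h1),
          Pi.one_apply, mul_one, mul_comm]
        exact le_add_self
      · simp [Set.indicator, hx]

end Rates

lemma exists_rpow_le_momentWeight {q θ : ℝ} (hq : q < θ) {ε : ℝ} (hε : 0 < ε) :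
    ∃ R : ℝ, 1 ≤ R ∧ ∀ x, R ≤ |x| → |x| ^ q ≤ ε * momentWeight θ x := by
  obtain ⟨R, hR⟩ := eventually_atTop.1
    ((tendsto_rpow_neg_atTop (sub_pos.2 hq)).eventually_le_const hε)
  refine ⟨max R 1, le_max_right _ _, fun x hx => ?_⟩
  have h0 : 0 < |x| := zero_lt_one.trans_le ((le_max_right _ _).trans hx)
  have h1 := hR |x| ((le_max_left _ _).trans hx)
  calc |x| ^ q = |x| ^ (-(θ - q)) * |x| ^ θ := by rw [← Real.rpow_add h0]; congr 1; ring
    _ ≤ ε * |x| ^ θ := by gcongr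
    _ ≤ ε * momentWeight θ x := by unfold momentWeight; gcongr; linarith

/-- The coagulation-fragmentation rate of change of `∫ φ dμ`. -/
def rateFun (a : ℝ → ℝ → ℝ) (b : ℝ → ℝ) (φ : ℝ → ℝ) (μ : Measure ℝ) : ℝ :=
  1 / 2 * (∫ x, ∫ y, a x y * (φ (x + y) - φ x - φ y) ∂μ ∂μ) -
    1 / 4 * ∫ x, b x * (φ x - 2 * φ (x / 2)) ∂μ

namespace Rates

variable {κ a : ℝ → ℝ → ℝ} {g b φ : ℝ → ℝ} {C p θ B c : ℝ} {μ : Measure ℝ}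

lemma abs_coag_mul_le (H : Rates κ g C p θ) (a0 : ∀ x y, 0 ≤ a x y)
    (aκ : ∀ x y, a x y ≤ κ x y) (hφ : ∀ x, |φ x| ≤ c * (1 + |x|)) {x y : ℝ} (hx : 0 < x) :
    |a x y * (φ (x + y) - φ x - φ y)| ≤
      (Set.Iic (2 * x)).indicator (fun _ => 12 * c * C * (x⁻¹ + x ^ 2)) y := by
  have hC := H.const_nonneg
  have hc : 0 ≤ c := by simpa using (abs_nonneg _).trans (hφ 0)
  by_cases hk : κ x y = 0
  · rw [le_antisymm ((aκ x y).trans hk.le) (a0 x y), zero_mul, abs_zero]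
    exact Set.indicator_nonneg (fun _ _ => by positivity) _
  obtain ⟨-, hxy, hyx⟩ := H.coag_supp x y hk
  have hy : 0 < y := by linarith
  rw [Set.indicator_of_mem (Set.mem_Iic.2 hyx), abs_mul, abs_of_nonneg (a0 x y)]
  have h1 : |φ (x + y) - φ x - φ y| ≤ 6 * c * (1 + x) := by
    have e1 := hφ (x + y)
    have e2 := hφ x
    have e3 := hφ y
    rw [abs_of_pos (add_pos hx hy)] at e1
    rw [abs_of_pos hx] at e2
    rw [abs_of_pos hy] at e3
    have e4 := (abs_sub (φ (x + y) - φ x) (φ y)).trans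
      (add_le_add_left (abs_sub (φ (x + y)) (φ x)) _)
    have : c * y ≤ c * (2 * x) := by gcongr
    nlinarith
  have h2 : (x⁻¹ + x) * (1 + x) ≤ 2 * (x⁻¹ + x ^ 2) := by
    have : 2 * (x⁻¹ + x ^ 2) - (x⁻¹ + x) * (1 + x) = x⁻¹ * ((x - 1) ^ 2 * (1 + x)) := by
      field_simp; ring
    have h3 : 0 ≤ x⁻¹ * ((x - 1) ^ 2 * (1 + x)) := by positivity
    linarith
  calc a x y * |φ (x + y) - φ x - φ y| ≤ (C * (x⁻¹ + x)) * (6 * c * (1 + x)) := by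
        gcongr; exact (aκ x y).trans (H.coag_le x y hx)
    _ = 6 * c * C * ((x⁻¹ + x) * (1 + x)) := by ring
    _ ≤ 6 * c * C * (2 * (x⁻¹ + x ^ 2)) := by gcongr
    _ = _ := by ring

lemma integral_coag_eq_zero (H : Rates κ g C p θ) (a0 : ∀ x y, 0 ≤ a x y)
    (aκ : ∀ x y, a x y ≤ κ x y) {x : ℝ} (hx : x ≤ 0) :
    ∫ y, a x y * (φ (x + y) - φ x - φ y) ∂μ = 0 := by
  have : ∀ y, a x y = 0 := fun y => by
    refine le_antisymm ((aκ x y).trans (le_of_eq ?_)) (a0 x y)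
    by_contra h
    exact hx.not_gt (H.coag_supp x y h).1
  simp [this]

lemma abs_integral_coag_le (H : Rates κ g C p θ) (hμ : SizeBound θ B μ) (a0 : ∀ x y, 0 ≤ a x y)
    (aκ : ∀ x y, a x y ≤ κ x y) (hφ : ∀ x, |φ x| ≤ c * (1 + |x|)) (x : ℝ) :
    |∫ y, a x y * (φ (x + y) - φ x - φ y) ∂μ| ≤ 24 * c * C * B * (1 + x ^ 2) := by
  have hC := H.const_nonneg
  have hB := hμ.nonneg
  have hc : 0 ≤ c := by simpa using (abs_nonneg _).trans (hφ 0)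
  have := hμ.isFiniteMeasure
  rcases le_or_gt x 0 with hx | hx
  · rw [H.integral_coag_eq_zero a0 aκ hx, abs_zero]; positivity
  have key := norm_integral_le_of_norm_le (μ := μ) (f := fun y => a x y * (φ (x + y) - φ x - φ y))
    ((integrable_const (12 * c * C * (x⁻¹ + x ^ 2))).indicator (measurableSet_Iic (a := 2 * x)))
    (Eventually.of_forall fun y => H.abs_coag_mul_le a0 aκ hφ (y := y) hx)
  rw [integral_indicator_const _ measurableSet_Iic, smul_eq_mul] at key
  refine key.trans ?_
  have h1 : μ.real (Set.Iic (2 * x)) ≤ B * (2 * x) := hμ.real_Iic_le (by positivity)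
  have h2 : μ.real (Set.Iic (2 * x)) ≤ B :=
    (measureReal_mono (Set.subset_univ _)).trans hμ.real_univ_le
  calc _ = 12 * c * C * (μ.real (Set.Iic (2 * x)) * x⁻¹ + μ.real (Set.Iic (2 * x)) * x ^ 2) := by
        ring
    _ ≤ 12 * c * C * (B * (2 * x) * x⁻¹ + B * x ^ 2) := by gcongr
    _ = 12 * c * C * B * (2 + x ^ 2) := by field_simp
    _ ≤ 12 * c * C * B * (2 + 2 * x ^ 2) := by gcongr; nlinarith [sq_nonneg x]
    _ = _ := by ring

lemma one_add_sq_le (H : Rates κ g C p θ) (x : ℝ) : 1 + x ^ 2 ≤ 2 * momentWeight θ x := by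
  have h1 := rpow_le_momentWeight zero_le_two H.two_lt.le x
  have h2 := one_le_momentWeight θ x
  rw [Real.rpow_two, sq_abs] at h1
  linarith

lemma measurable_integral_coag [SFinite μ] (ha : Measurable (Function.uncurry a))
    (hφ : Continuous φ) : Measurable fun x => ∫ y, a x y * (φ (x + y) - φ x - φ y) ∂μ := by
  have : Measurable (Function.uncurry fun x y => a x y * (φ (x + y) - φ x - φ y)) := by
    refine ha.mul (Continuous.measurable ?_)
    fun_prop
  exact (this.stronglyMeasurable.integral_prod_right (ν := μ)).measurable

lemma integrable_integral_coag (H : Rates κ g C p θ) (hμ : SizeBound θ B μ)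
    (ha : Measurable (Function.uncurry a)) (a0 : ∀ x y, 0 ≤ a x y) (aκ : ∀ x y, a x y ≤ κ x y)
    (hφc : Continuous φ) (hφ : ∀ x, |φ x| ≤ c * (1 + |x|)) :
    Integrable (fun x => ∫ y, a x y * (φ (x + y) - φ x - φ y) ∂μ) μ := by
  have hC := H.const_nonneg
  have hB := hμ.nonneg
  have hc : 0 ≤ c := by simpa using (abs_nonneg _).trans (hφ 0)
  have := hμ.isFiniteMeasure
  refine hμ.integrable_of_le (by linarith [H.two_lt])
    (measurable_integral_coag ha hφc).aestronglyMeasurable (c := 48 * c * C * B) fun x => ?_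
  calc _ ≤ 24 * c * C * B * (1 + x ^ 2) := H.abs_integral_coag_le hμ a0 aκ hφ x
    _ ≤ 24 * c * C * B * (2 * momentWeight θ x) := by gcongr; exact H.one_add_sq_le x
    _ = _ := by ring

lemma abs_frag_mul_le (H : Rates κ g C p θ) (b0 : ∀ x, 0 ≤ b x) (bg : ∀ x, b x ≤ g x)
    (hφ : ∀ x, |φ x| ≤ c * (1 + |x|)) (x : ℝ) :
    |b x * (φ x - 2 * φ (x / 2))| ≤ 3 * c * C * ((1 + |x|) * (1 + |x| ^ p)) := by
  have hC := H.const_nonneg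
  have hc : 0 ≤ c := by simpa using (abs_nonneg _).trans (hφ 0)
  have h1 : |φ x - 2 * φ (x / 2)| ≤ 3 * c * (1 + |x|) := by
    have e1 := hφ x
    have e2 := hφ (x / 2)
    rw [abs_div, abs_two] at e2
    have e3 := abs_sub (φ x) (2 * φ (x / 2))
    rw [abs_mul, abs_two] at e3
    nlinarith [mul_nonneg hc (abs_nonneg x)]
  rw [abs_mul, abs_of_nonneg (b0 x)]
  calc b x * |φ x - 2 * φ (x / 2)| ≤ (C * (1 + |x| ^ p)) * (3 * c * (1 + |x|)) := by
        gcongr; exact (bg x).trans (H.frag_le x)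
    _ = _ := by ring

lemma frag_growth_le (H : Rates κ g C p θ) (x : ℝ) :
    (1 + |x|) * (1 + |x| ^ p) ≤ 4 * momentWeight θ x := by
  have h1 := H.one_le
  have h2 := H.lt
  have e0 := one_le_momentWeight θ x
  have e1 := rpow_le_momentWeight zero_le_one (by linarith : 1 ≤ θ) x
  have e2 := rpow_le_momentWeight (by linarith : 0 ≤ p) (by linarith : p ≤ θ) x
  have e3 := rpow_le_momentWeight (by linarith : 0 ≤ p + 1) (by linarith : p + 1 ≤ θ) x
  rw [Real.rpow_one] at e1
  rw [Real.rpow_add_one' (abs_nonneg x) (by linarith)] at e3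
  nlinarith

lemma exists_frag_growth_le (H : Rates κ g C p θ) {ε : ℝ} (hε : 0 < ε) :
    ∃ R : ℝ, ∀ x, R ≤ |x| → (1 + |x|) * (1 + |x| ^ p) ≤ ε * momentWeight θ x := by
  obtain ⟨R, hR1, hR⟩ := exists_rpow_le_momentWeight H.lt (show 0 < ε / 4 by positivity)
  refine ⟨R, fun x hx => ?_⟩
  have h1 := hR1.trans hx
  have h2 := Real.one_le_rpow h1 (by linarith [H.one_le] : 0 ≤ p)
  have h3 := hR x hx
  rw [Real.rpow_add_one (by linarith)] at h3
  nlinarith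

lemma abs_rateFun_le (H : Rates κ g C p θ) (hμ : SizeBound θ B μ)
    (a0 : ∀ x y, 0 ≤ a x y) (aκ : ∀ x y, a x y ≤ κ x y)
    (b0 : ∀ x, 0 ≤ b x) (bg : ∀ x, b x ≤ g x) (hφ : ∀ x, |φ x| ≤ c * (1 + |x|)) :
    |rateFun a b φ μ| ≤ 24 * c * C * B * B + 3 * c * C * B := by
  have hC := H.const_nonneg
  have hB := hμ.nonneg
  have hθ := H.two_lt
  have hc : 0 ≤ c := by simpa using (abs_nonneg _).trans (hφ 0)
  have h1 := hμ.abs_integral_le (by linarith) (c := 48 * c * C * B) (by positivity)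
    (ψ := fun x => ∫ y, a x y * (φ (x + y) - φ x - φ y) ∂μ) fun x => by
      calc _ ≤ 24 * c * C * B * (1 + x ^ 2) := H.abs_integral_coag_le hμ a0 aκ hφ x
        _ ≤ 24 * c * C * B * (2 * momentWeight θ x) := by gcongr; exact H.one_add_sq_le x
        _ = _ := by ring
  have h2 := hμ.abs_integral_le (by linarith) (c := 12 * c * C) (by positivity)
    (ψ := fun x => b x * (φ x - 2 * φ (x / 2))) fun x => by
      calc _ ≤ 3 * c * C * ((1 + |x|) * (1 + |x| ^ p)) := H.abs_frag_mul_le b0 bg hφ x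
        _ ≤ 3 * c * C * (4 * momentWeight θ x) :=
          mul_le_mul_of_nonneg_left (H.frag_growth_le x) (by positivity)
        _ = _ := by ring
  unfold rateFun
  rw [abs_le] at h1 h2 ⊢
  constructor <;> linarith

lemma tendsto_frag (H : Rates κ g C p θ) {ι : Type*} {l : Filter ι} {μ : ι → Measure ℝ}
    {ν : Measure ℝ} (hμ : ∀ᶠ i in l, SizeBound θ B (μ i)) (hν : SizeBound θ B ν)
    (hv : VagueTendsto l μ ν) {N : ι → ℝ} (hN : Tendsto N l atTop) (hφc : Continuous φ)
    (hφ : ∀ x, |φ x| ≤ c * (1 + |x|)) :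
    Tendsto (fun i => ∫ x, min (g x) (N i) * (φ x - 2 * φ (x / 2)) ∂(μ i)) l
      (𝓝 (∫ x, g x * (φ x - 2 * φ (x / 2)) ∂ν)) := by
  have hC := H.const_nonneg
  have hB := hν.nonneg
  have hθ := H.two_lt
  have hp := H.one_le
  have hc : 0 ≤ c := by simpa using (abs_nonneg _).trans (hφ 0)
  have hψc : Continuous fun x => φ x - 2 * φ (x / 2) := by fun_prop
  have hlim : Tendsto (fun i => ∫ x, g x * (φ x - 2 * φ (x / 2)) ∂(μ i)) l
      (𝓝 (∫ x, g x * (φ x - 2 * φ (x / 2)) ∂ν)) := by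
    refine tendsto_integral_of_vague (by linarith) hμ hν hv (H.cont_frag.mul hψc) fun ε hε => ?_
    obtain ⟨R, hR⟩ := H.exists_frag_growth_le (ε := ε / (3 * c * C + 1)) (by positivity)
    refine ⟨R, fun x hx => ?_⟩
    have w0 := momentWeight_pos θ x
    calc _ ≤ 3 * c * C * ((1 + |x|) * (1 + |x| ^ p)) :=
          H.abs_frag_mul_le H.frag_nonneg (fun _ => le_rfl) hφ x
      _ ≤ (3 * c * C + 1) * (ε / (3 * c * C + 1) * momentWeight θ x) := by
          exact mul_le_mul (by linarith) (hR x hx) (by positivity) (by positivity)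
      _ = _ := by field_simp
  refine tendsto_of_forall_approx (C := 3 * c * C * B) fun ε hε => ⟨_, _, hlim, ?_, ?_⟩
  swap
  · rw [sub_self, abs_zero]; positivity
  obtain ⟨R, hR⟩ := H.exists_frag_growth_le hε
  filter_upwards [hμ, hN.eventually_ge_atTop (C * (1 + |R| ^ p)), hN.eventually_ge_atTop 0]
    with i hi hNi hNi0
  have hint : ∀ b : ℝ → ℝ, Measurable b → (∀ x, 0 ≤ b x) → (∀ x, b x ≤ g x) →
      Integrable (fun x => b x * (φ x - 2 * φ (x / 2))) (μ i) := fun b hb b0 bg => by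
    refine hi.integrable_of_le (by linarith) (hb.mul hψc.measurable).aestronglyMeasurable
      (c := 12 * c * C) fun x => ?_
    calc _ ≤ 3 * c * C * ((1 + |x|) * (1 + |x| ^ p)) := H.abs_frag_mul_le b0 bg hφ x
      _ ≤ 3 * c * C * (4 * momentWeight θ x) :=
          mul_le_mul_of_nonneg_left (H.frag_growth_le x) (by positivity)
      _ = _ := by ring
  rw [← integral_sub (hint _ (H.cont_frag.measurable.min measurable_const)
    (fun x => le_min (H.frag_nonneg x) hNi0) fun x => min_le_left _ _)
    (hint _ H.cont_frag.measurable H.frag_nonneg fun _ => le_rfl)]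
  refine (hi.abs_integral_le (by linarith) (c := 3 * c * C * ε) (by positivity)
    fun x => ?_).trans (le_of_eq (by ring))
  have w0 := momentWeight_pos θ x
  rcases le_or_gt R |x| with hx | hx
  · have : |min (g x) (N i) * (φ x - 2 * φ (x / 2)) - g x * (φ x - 2 * φ (x / 2))| ≤
        |g x * (φ x - 2 * φ (x / 2))| := by
      rw [← sub_mul, abs_mul, abs_mul, abs_of_nonneg (H.frag_nonneg x)]
      gcongr
      rw [abs_le]
      have h1 : 0 ≤ min (g x) (N i) := le_min (H.frag_nonneg x) hNi0
      have h2 := min_le_left (g x) (N i)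
      constructor <;> linarith [H.frag_nonneg x]
    calc _ ≤ 3 * c * C * ((1 + |x|) * (1 + |x| ^ p)) :=
          this.trans (H.abs_frag_mul_le H.frag_nonneg (fun _ => le_rfl) hφ x)
      _ ≤ 3 * c * C * (ε * momentWeight θ x) :=
          mul_le_mul_of_nonneg_left (hR x hx) (by positivity)
      _ = _ := by ring
  · have : g x ≤ N i := by
      refine (H.frag_le x).trans (le_trans ?_ hNi)
      have : |x| ^ p ≤ |R| ^ p :=
        Real.rpow_le_rpow (abs_nonneg x) (hx.le.trans (le_abs_self R)) (by linarith)
      gcongr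
    rw [min_eq_left this, sub_self, abs_zero]
    positivity

/-- A continuous cutoff equal to `1` on `[2δ, R]` and vanishing off `(δ, R + 1)`. -/
def window (δ R x : ℝ) : ℝ := max 0 (min 1 (x / δ - 1)) * max 0 (min 1 (R + 1 - x))

lemma continuous_window (δ R : ℝ) : Continuous (window δ R) := by unfold window; fun_prop

lemma window_nonneg (δ R x : ℝ) : 0 ≤ window δ R x :=
  mul_nonneg (le_max_left _ _) (le_max_left _ _)

lemma window_le_one (δ R x : ℝ) : window δ R x ≤ 1 :=
  mul_le_one₀ (max_le zero_le_one (min_le_left _ _)) (le_max_left _ _)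
    (max_le zero_le_one (min_le_left _ _))

lemma window_eq_one {δ R x : ℝ} (hδ : 0 < δ) (h1 : 2 * δ ≤ x) (h2 : x ≤ R) :
    window δ R x = 1 := by
  have : 2 ≤ x / δ := (le_div_iff₀ hδ).2 h1
  unfold window
  rw [min_eq_left (by linarith), min_eq_left (by linarith), max_eq_right zero_le_one, one_mul]

lemma mem_of_window_ne_zero {δ R x : ℝ} (hδ : 0 < δ) (h : window δ R x ≠ 0) :
    δ < x ∧ x < R + 1 := by
  unfold window at h
  constructor <;> by_contra! hx <;> apply h
  · have : x / δ ≤ 1 := (div_le_one hδ).2 hx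
    rw [max_eq_left ((min_le_right _ _).trans (by linarith)), zero_mul]
  · rw [max_eq_left (a := 0) (b := min 1 (R + 1 - x)) ((min_le_right _ _).trans (by linarith)),
      mul_zero]

lemma abs_window_error_le (H : Rates κ g C p θ) (hμ : SizeBound θ B μ)
    (ha : Measurable (Function.uncurry a)) (a0 : ∀ x y, 0 ≤ a x y) (aκ : ∀ x y, a x y ≤ κ x y)
    (hφc : Continuous φ) (hφ : ∀ x, |φ x| ≤ c * (1 + |x|)) {ε δ R : ℝ} (hε : 0 < ε)
    (hδ : 0 < δ) (hδ1 : δ ≤ 1) (hδε : δ ≤ ε)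
    (hR : ∀ x, R ≤ |x| → 1 + x ^ 2 ≤ ε * momentWeight θ x) :
    |(∫ x, ∫ y, a x y * (φ (x + y) - φ x - φ y) ∂μ ∂μ) -
      ∫ x, window δ R x * ∫ y, a x y * (φ (x + y) - φ x - φ y) ∂μ ∂μ| ≤
      264 * c * C * B * B * ε := by
  have hC := H.const_nonneg
  have hB := hμ.nonneg
  have hc : 0 ≤ c := by simpa using (abs_nonneg _).trans (hφ 0)
  have := hμ.isFiniteMeasure
  have hi := H.integrable_integral_coag hμ ha a0 aκ hφc hφ
  have hi2 := hi.bdd_mul (c := 1) (f := window δ R) (continuous_window δ R).aestronglyMeasurable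
    (Eventually.of_forall fun x => by
      rw [Real.norm_eq_abs, abs_of_nonneg (window_nonneg δ R x)]; exact window_le_one δ R x)
  rw [← integral_sub hi hi2]
  have hdom : Integrable (fun x => (Set.Iic (2 * δ)).indicator (fun _ => 120 * c * C * B) x +
      24 * c * C * B * ε * momentWeight θ x) μ :=
    ((integrable_const _).indicator measurableSet_Iic).add
      ((hμ.integrable_weight (by linarith [H.two_lt])).const_mul _)
  rw [← Real.norm_eq_abs]
  refine (norm_integral_le_of_norm_le hdom (Eventually.of_forall fun x => ?_)).trans ?_
  · have hH := H.abs_integral_coag_le hμ a0 aκ hφ x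
    have w0 := momentWeight_pos θ x
    have e1 : 0 ≤ (Set.Iic (2 * δ)).indicator (fun _ => 120 * c * C * B) x :=
      Set.indicator_nonneg (fun _ _ => by positivity) _
    have e2 : 0 ≤ 24 * c * C * B * ε * momentWeight θ x := by positivity
    have e3 : ‖(∫ y, a x y * (φ (x + y) - φ x - φ y) ∂μ) -
        window δ R x * ∫ y, a x y * (φ (x + y) - φ x - φ y) ∂μ‖ ≤
        |∫ y, a x y * (φ (x + y) - φ x - φ y) ∂μ| := by
      rw [← one_sub_mul, norm_mul, Real.norm_eq_abs, Real.norm_eq_abs]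
      refine mul_le_of_le_one_left (abs_nonneg _) (abs_le.2 ⟨?_, ?_⟩) <;>
        linarith [window_nonneg δ R x, window_le_one δ R x]
    rcases le_or_gt x 0 with hx0 | hx0
    · rw [H.integral_coag_eq_zero a0 aκ hx0, mul_zero, sub_self, norm_zero]
      linarith
    rcases le_or_gt x (2 * δ) with hx | hx
    · rw [Set.indicator_of_mem (Set.mem_Iic.2 hx)]
      have : 1 + x ^ 2 ≤ 5 := by nlinarith
      have : 24 * c * C * B * (1 + x ^ 2) ≤ 24 * c * C * B * 5 := by gcongr
      linarith
    rcases le_or_gt x R with hxR | hxR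
    · rw [window_eq_one hδ hx.le hxR, one_mul, sub_self, norm_zero]
      linarith
    · have := hR x (hxR.le.trans (le_abs_self x))
      have : 24 * c * C * B * (1 + x ^ 2) ≤ 24 * c * C * B * (ε * momentWeight θ x) := by gcongr
      linarith
  · rw [integral_add ((integrable_const _).indicator measurableSet_Iic)
      ((hμ.integrable_weight (by linarith [H.two_lt])).const_mul _),
      integral_indicator_const _ measurableSet_Iic, integral_const_mul, smul_eq_mul]
    calc _ ≤ B * (2 * ε) * (120 * c * C * B) + 24 * c * C * B * ε * B := by
          gcongr
          · exact (hμ.real_Iic_le (by positivity)).trans (by gcongr)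
          · exact hμ.integral_weight_le (by linarith [H.two_lt])
      _ = _ := by ring

lemma tendsto_coag (H : Rates κ g C p θ) {ι : Type*} {l : Filter ι} {μ : ι → Measure ℝ}
    {ν : Measure ℝ} (hμ : ∀ᶠ i in l, SizeBound θ B (μ i)) (hν : SizeBound θ B ν)
    (hv : VagueTendsto l μ ν) {N : ι → ℝ} (hN : Tendsto N l atTop) (hφc : Continuous φ)
    (hφ : ∀ x, |φ x| ≤ c * (1 + |x|)) :
    Tendsto (fun i => ∫ x, ∫ y, min (κ x y) (N i) * (φ (x + y) - φ x - φ y) ∂(μ i) ∂(μ i)) l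
      (𝓝 (∫ x, ∫ y, κ x y * (φ (x + y) - φ x - φ y) ∂ν ∂ν)) := by
  have hC := H.const_nonneg
  refine tendsto_of_forall_approx (C := 264 * c * C * B * B) fun ε hε => ?_
  obtain ⟨R, hR1, hR⟩ := exists_rpow_le_momentWeight H.two_lt (show 0 < ε / 2 by positivity)
  have hR' : ∀ x, R ≤ |x| → 1 + x ^ 2 ≤ ε * momentWeight θ x := fun x hx => by
    have h1 := hR x hx
    rw [Real.rpow_two, sq_abs] at h1
    have h2 : 1 ≤ x ^ 2 := by rw [← sq_abs]; nlinarith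
    linarith
  set δ := min ε 1
  have hδ : 0 < δ := lt_min hε one_pos
  have hδ1 : δ ≤ 1 := min_le_right _ _
  have hδε : δ ≤ ε := min_le_left _ _
  set G : ℝ → ℝ → ℝ := fun x y =>
    window δ R x * (κ (max x δ) (max y (δ / 2)) * (φ (x + y) - φ x - φ y))
  have hGeq : ∀ x y, G x y = window δ R x * (κ x y * (φ (x + y) - φ x - φ y)) := fun x y => by
    by_cases hw : window δ R x = 0
    · simp [G, hw]
    obtain ⟨h1, -⟩ := mem_of_window_ne_zero hδ hw
    simp only [G]
    rw [max_eq_left h1.le]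
    rcases le_or_gt (δ / 2) y with hy | hy
    · rw [max_eq_left hy]
    · have z : ∀ y', y' ≤ δ / 2 → κ x y' = 0 := fun y' hy' => by
        by_contra h
        linarith [(H.coag_supp x y' h).2.1]
      rw [max_eq_right hy.le, z y hy.le, z _ le_rfl]
  have hGc : Continuous (Function.uncurry G) := by
    have h1 : Continuous fun q : ℝ × ℝ => κ (max q.1 δ) (max q.2 (δ / 2)) := by
      have : Continuous fun q : ℝ × ℝ => (max q.1 δ, max q.2 (δ / 2)) := by fun_prop
      exact H.cont_coag.comp_continuous this fun q =>
        ⟨hδ.trans_le (le_max_right _ _), (half_pos hδ).trans_le (le_max_right _ _)⟩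
    have h2 : Continuous fun q : ℝ × ℝ => window δ R q.1 :=
      (continuous_window δ R).comp continuous_fst
    exact h2.mul (h1.mul (by fun_prop))
  have hGs : HasCompactSupport (Function.uncurry G) := by
    refine HasCompactSupport.intro ((isCompact_Icc (a := δ) (b := R + 1)).prod
      (isCompact_Icc (a := 0) (b := 2 * (R + 1)))) fun q hq => ?_
    change G q.1 q.2 = 0
    by_contra h
    rw [hGeq] at h
    obtain ⟨h1, h2⟩ := mem_of_window_ne_zero hδ (left_ne_zero_of_mul h)
    obtain ⟨h3, h4, h5⟩ := H.coag_supp _ _ (left_ne_zero_of_mul (right_ne_zero_of_mul h))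
    exact hq ⟨⟨h1.le, h2.le⟩, ⟨by linarith, by linarith⟩⟩
  have hGi : ∀ ρ : Measure ℝ, ∫ x, ∫ y, G x y ∂ρ ∂ρ =
      ∫ x, window δ R x * ∫ y, κ x y * (φ (x + y) - φ x - φ y) ∂ρ ∂ρ := fun ρ => by
    simp only [hGeq, integral_const_mul]
  refine ⟨_, _, tendsto_double_integral_of_vague hμ hν hv hGc hGs, ?_, ?_⟩
  · filter_upwards [hμ, hN.eventually_ge_atTop (C * (δ⁻¹ + (R + 1))), hN.eventually_ge_atTop 0]
      with i hi hNi hNi0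
    have : ∫ x, ∫ y, G x y ∂(μ i) ∂(μ i) = ∫ x, window δ R x *
        ∫ y, min (κ x y) (N i) * (φ (x + y) - φ x - φ y) ∂(μ i) ∂(μ i) := by
      rw [hGi]
      refine integral_congr_ae (Eventually.of_forall fun x => ?_)
      by_cases hw : window δ R x = 0
      · simp [hw]
      obtain ⟨h1, h2⟩ := mem_of_window_ne_zero hδ hw
      have hx : 0 < x := hδ.trans h1
      have h3 : ∀ y, min (κ x y) (N i) = κ x y := fun y => min_eq_left <|
        (H.coag_le x y hx).trans (le_trans (by gcongr) hNi)
      simp only [h3]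
    rw [this]
    have HB := H.bounded hNi0
    exact H.abs_window_error_le hi HB.meas_coag HB.coag_nonneg (fun _ _ => min_le_left _ _)
      hφc hφ hε hδ hδ1 hδε hR'
  · rw [hGi]
    exact H.abs_window_error_le hν H.meas_coag H.coag_nonneg (fun _ _ => le_rfl)
      hφc hφ hε hδ hδ1 hδε hR'

lemma tendsto_rateFun (H : Rates κ g C p θ) {ι : Type*} {l : Filter ι} {μ : ι → Measure ℝ}
    {ν : Measure ℝ} (hμ : ∀ᶠ i in l, SizeBound θ B (μ i)) (hν : SizeBound θ B ν)
    (hv : VagueTendsto l μ ν) {N : ι → ℝ} (hN : Tendsto N l atTop) (hφc : Continuous φ)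
    (hφ : ∀ x, |φ x| ≤ c * (1 + |x|)) :
    Tendsto (fun i => rateFun (fun x y => min (κ x y) (N i)) (fun x => min (g x) (N i)) φ (μ i)) l
      (𝓝 (rateFun κ g φ ν)) :=
  ((H.tendsto_coag hμ hν hv hN hφc hφ).const_mul _).sub
    ((H.tendsto_frag hμ hν hv hN hφc hφ).const_mul _)

end Rates

lemma continuousOn_of_tendsto_prod {ι : Type*} {l : Filter ι} [l.NeBot] {S : Set ℝ}
    {u : ι → ℝ → ℝ} {v : ℝ → ℝ}
    (h : ∀ s ∈ S, Tendsto (fun q : ι × ℝ => u q.1 q.2) (l ×ˢ 𝓝[S] s) (𝓝 (v s))) :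
    ContinuousOn v S := by
  intro s hs
  refine Metric.nhds_basis_closedBall.tendsto_right_iff.2 fun ε hε => ?_
  obtain ⟨pa, hpa, pb, hpb, H⟩ :=
    eventually_prod_iff.1 ((h s hs).eventually (Metric.closedBall_mem_nhds _ hε))
  filter_upwards [hpb, self_mem_nhdsWithin] with s' hs' hS
  have : Tendsto (fun n => u n s') l (𝓝 (v s')) :=
    (h s' hS).comp (tendsto_id.prodMk (tendsto_const_pure.mono_right (pure_le_nhdsWithin hS)))
  exact Metric.isClosed_closedBall.mem_of_tendsto this (hpa.mono fun n hn => H hn hs')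

lemma abs_sub_le_of_euler {u r : ℕ → ℝ} {h t t' ρ c : ℝ} (hh : 0 < h) (ht : 0 ≤ t) (htt : t ≤ t')
    (hstep : ∀ j : ℕ, j * h ≤ t' → u (j + 1) - u j = h * r j)
    (hr : ∀ s ∈ Set.Icc t t', |r ⌊s / h⌋₊ - ρ| ≤ c) :
    |u ⌊t' / h⌋₊ - u ⌊t / h⌋₊ - (t' - t) * ρ| ≤ c * (t' - t + h) + h * |ρ| := by
  have hc : 0 ≤ c := (abs_nonneg _).trans (hr t ⟨le_rfl, htt⟩)
  set J := ⌊t / h⌋₊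
  have hJ : (J : ℝ) * h ≤ t := (le_div_iff₀ hh).1 (Nat.floor_le (by positivity))
  have hJ' : t < ((J : ℝ) + 1) * h := (div_lt_iff₀ hh).1 (Nat.lt_floor_add_one _)
  have hrj : ∀ j : ℕ, J ≤ j → j * h ≤ t' → |r j - ρ| ≤ c := fun j hj hjt => by
    have hfl : ⌊max t (j * h) / h⌋₊ = j := by
      rw [Nat.floor_eq_iff (by positivity)]
      refine ⟨(le_div_iff₀ hh).2 (le_max_right _ _), (div_lt_iff₀ hh).2 (max_lt ?_ (by linarith))⟩
      refine hJ'.trans_le ?_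
      have : (J : ℝ) ≤ j := by exact_mod_cast hj
      gcongr
    have := hr (max t (j * h)) ⟨le_max_left _ _, max_le htt hjt⟩
    rwa [hfl] at this
  have key : ∀ j : ℕ, J ≤ j → j * h ≤ t' →
      |u j - u J - ((j : ℝ) - J) * h * ρ| ≤ c * (((j : ℝ) - J) * h) := fun j hj => by
    induction j, hj using Nat.le_induction with
    | base => simp
    | succ j hj ih =>
      intro hjt
      push_cast at hjt ⊢
      have hjt' : j * h ≤ t' := by linarith
      have h1 := ih hjt'
      have h2 := hstep j hjt'
      have h3 := hrj j hj hjt'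
      have h4 : u (j + 1) - u J - ((j : ℝ) + 1 - J) * h * ρ =
          (u j - u J - ((j : ℝ) - J) * h * ρ) + h * (r j - ρ) := by linear_combination h2
      rw [h4]
      refine (abs_add_le _ _).trans ?_
      rw [abs_mul, abs_of_pos hh]
      have : h * |r j - ρ| ≤ h * c := by gcongr
      linarith
  set K := ⌊t' / h⌋₊
  have hK : (K : ℝ) * h ≤ t' := (le_div_iff₀ hh).1 (Nat.floor_le (div_nonneg (ht.trans htt) hh.le))
  have hK' : t' < ((K : ℝ) + 1) * h := (div_lt_iff₀ hh).1 (Nat.lt_floor_add_one _)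
  have h1 := key K (Nat.floor_le_floor (by gcongr)) hK
  have h2 : |((K : ℝ) - J) * h - (t' - t)| ≤ h := by rw [abs_le]; constructor <;> linarith
  have h3 : u K - u J - (t' - t) * ρ = (u K - u J - ((K : ℝ) - J) * h * ρ) +
      (((K : ℝ) - J) * h - (t' - t)) * ρ := by ring
  rw [h3]
  refine (abs_add_le _ _).trans (add_le_add (h1.trans ?_) ?_)
  · gcongr
    linarith [(abs_le.1 h2).2]
  · rw [abs_mul]; gcongr

/-- Limits of explicit Euler schemes solve the integrated equation. -/
lemma integral_eq_of_tendsto_euler {l : Filter ℕ} [l.NeBot] {h : ℕ → ℝ} (hpos : ∀ n, 0 < h n)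
    (hlim : Tendsto h l (𝓝 0)) {u r : ℕ → ℕ → ℝ} {G ρ : ℝ → ℝ}
    (hstep : ∀ T : ℝ, ∀ᶠ n in l, ∀ j : ℕ, j * h n ≤ T → u n (j + 1) - u n j = h n * r n j)
    (hG : ∀ t ∈ Set.Ici (0 : ℝ), Tendsto (fun q : ℕ × ℝ => u q.1 ⌊q.2 / h q.1⌋₊)
      (l ×ˢ 𝓝[Set.Ici 0] t) (𝓝 (G t)))
    (hρ : ∀ t ∈ Set.Ici (0 : ℝ), Tendsto (fun q : ℕ × ℝ => r q.1 ⌊q.2 / h q.1⌋₊)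
      (l ×ˢ 𝓝[Set.Ici 0] t) (𝓝 (ρ t))) :
    ContinuousOn G (Set.Ici 0) ∧ ∀ t, 0 ≤ t → G t - G 0 = ∫ s in (0 : ℝ)..t, ρ s := by
  have cG : ContinuousOn G (Set.Ici 0) :=
    continuousOn_of_tendsto_prod (u := fun n s => u n ⌊s / h n⌋₊) hG
  have cρ : ContinuousOn ρ (Set.Ici 0) :=
    continuousOn_of_tendsto_prod (u := fun n s => r n ⌊s / h n⌋₊) hρ
  have pG : ∀ t, 0 ≤ t → Tendsto (fun n => u n ⌊t / h n⌋₊) l (𝓝 (G t)) := fun t ht =>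
    (hG t ht).comp (tendsto_id.prodMk (tendsto_const_pure.mono_right (pure_le_nhdsWithin ht)))
  refine ⟨cG, fun t ht => ?_⟩
  have hsub : Set.Icc 0 t ⊆ Set.Ici 0 := Set.Icc_subset_Ici_self
  refine (intervalIntegral.integral_eq_sub_of_hasDeriv_right_of_le ht (cG.mono hsub)
    (fun x hx => ?_) ((cρ.mono hsub).intervalIntegrable_of_Icc ht)).symm
  have hx0 : 0 ≤ x := hx.1.le
  rw [hasDerivWithinAt_iff_isLittleO, isLittleO_iff]
  intro c hc
  obtain ⟨pa, hpa, pb, hpb, H⟩ :=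
    eventually_prod_iff.1 ((hρ x hx0).eventually (Metric.closedBall_mem_nhds _ hc))
  obtain ⟨δ, hδ, hball⟩ := Metric.mem_nhdsWithin_iff.1 hpb
  filter_upwards [Ioo_mem_nhdsGT (show x < x + δ by linarith)] with y hy
  rw [Real.norm_eq_abs, Real.norm_eq_abs, smul_eq_mul, abs_of_pos (sub_pos.2 hy.1)]
  have hL : Tendsto (fun n => |u n ⌊y / h n⌋₊ - u n ⌊x / h n⌋₊ - (y - x) * ρ x|) l
      (𝓝 |G y - G x - (y - x) * ρ x|) :=
    (((pG y (hx0.trans hy.1.le)).sub (pG x hx0)).sub_const _).abs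
  have hR : Tendsto (fun n => c * (y - x + h n) + h n * |ρ x|) l
      (𝓝 (c * (y - x + 0) + 0 * |ρ x|)) :=
    ((hlim.const_add _).const_mul c).add (hlim.mul_const _)
  rw [add_zero, zero_mul, add_zero] at hR
  refine le_of_tendsto_of_tendsto hL hR ?_
  filter_upwards [hpa, hstep y] with n hn hs
  refine abs_sub_le_of_euler (hpos n) hx0 hy.1.le hs fun s hs' => ?_
  have hs0 : s ∈ Metric.ball x δ := by
    rw [Metric.mem_ball, Real.dist_eq, abs_of_nonneg (sub_nonneg.2 hs'.1)]
    linarith [hs'.2, hy.2]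
  exact H hn (hball ⟨hs0, hx0.trans hs'.1⟩)

lemma SizeBound.integrable_of_linear_growth {θ B c : ℝ} {μ : Measure ℝ} (hμ : SizeBound θ B μ)
    (hθ : 1 ≤ θ) {φ : ℝ → ℝ} (hφc : Continuous φ) (hφ : ∀ x, |φ x| ≤ c * (1 + |x|)) :
    Integrable φ μ := by
  have hc : 0 ≤ c := by simpa using (abs_nonneg _).trans (hφ 0)
  refine hμ.integrable_of_le (by linarith) hφc.aestronglyMeasurable (c := c * 2) fun x => ?_
  have h1 := one_le_momentWeight θ x
  have h2 := rpow_le_momentWeight zero_le_one hθ x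
  rw [Real.rpow_one] at h2
  calc _ ≤ c * (1 + |x|) := hφ x
    _ ≤ c * (2 * momentWeight θ x) := by gcongr; linarith
    _ = _ := by ring

namespace Rates

variable {κ : ℝ → ℝ → ℝ} {g : ℝ → ℝ} {C p θ N B h m T c : ℝ} {f : Measure ℝ}

/-- The explicit Euler scheme with step `h` for the rates truncated at height `N`. -/
def eulerSeq (κ : ℝ → ℝ → ℝ) (g : ℝ → ℝ) (N h : ℝ) (f : Measure ℝ) (j : ℕ) : Measure ℝ :=
  (eulerStep (fun x y => min (κ x y) N) (fun x => min (g x) N) h)^[j] f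

lemma eulerSeq_succ (j : ℕ) : eulerSeq κ g N h f (j + 1) =
    eulerStep (fun x y => min (κ x y) N) (fun x => min (g x) N) h (eulerSeq κ g N h f j) :=
  Function.iterate_succ_apply' _ _ _

lemma step_admissible {M : ℝ} (hM : 0 ≤ M) (hN : 0 ≤ N) (hh : 0 ≤ h)
    (hA : h * (N * (B * Real.exp (M * T)) + N) ≤ 1) (hB : 0 ≤ B) {j : ℕ} (hj : j * h ≤ T)
    {μ : Measure ℝ} (hμ : SizeBound θ (B * Real.exp (M * (j * h))) μ) :
    h * (N * μ.real Set.univ + N) ≤ 1 := by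
  refine le_trans ?_ hA
  gcongr
  exact hμ.real_univ_le.trans (by gcongr)

lemma sizeBound_eulerSeq (H : Rates κ g C p θ) (hN : 0 ≤ N) (hh : 0 ≤ h) (hm : 0 ≤ m)
    (hf : SizeBound θ B f) (hfm : ∫⁻ x, ENNReal.ofReal |x| ∂f ≤ ENNReal.ofReal m)
    {M : ℝ} (hM : M = C * (2 * 3 ^ θ * m + 1))
    (hA : h * (N * (B * Real.exp (M * T)) + N) ≤ 1) (j : ℕ) (hj : j * h ≤ T) :
    SizeBound θ (B * Real.exp (M * (j * h))) (eulerSeq κ g N h f j) ∧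
      ∫⁻ x, ENNReal.ofReal |x| ∂(eulerSeq κ g N h f j) ≤ ENNReal.ofReal m := by
  have hC := H.const_nonneg
  have hM0 : 0 ≤ M := by rw [hM]; positivity
  have hB := hf.nonneg
  induction j with
  | zero => simpa [eulerSeq] using And.intro hf hfm
  | succ j ih =>
    push_cast at hj
    have hj' : j * h ≤ T := by linarith
    obtain ⟨h1, h2⟩ := ih hj'
    have hadm := step_admissible hM0 hN hh hA hB hj' h1
    have := h1.isFiniteMeasure
    rw [eulerSeq_succ]
    refine ⟨(H.sizeBound_eulerStep hN hh hm h1 h2 hadm).mono ?_,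
      (H.lintegral_abs_eulerStep_le hN hh hadm).trans h2⟩
    rw [← hM, mul_assoc]
    gcongr
    push_cast
    rw [show M * ((j + 1) * h) = M * (j * h) + M * h by ring, Real.exp_add]
    gcongr
    linarith [Real.add_one_le_exp (M * h)]

lemma integral_eulerSeq_succ (H : Rates κ g C p θ) (hN : 0 ≤ N) (hh : 0 ≤ h) {j : ℕ}
    (hf : SizeBound θ B (eulerSeq κ g N h f j))
    (hA : h * (N * (eulerSeq κ g N h f j).real Set.univ + N) ≤ 1) {φ : ℝ → ℝ}
    (hφc : Continuous φ) (hφ : ∀ x, |φ x| ≤ c * (1 + |x|)) :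
    (∫ x, φ x ∂(eulerSeq κ g N h f (j + 1))) - ∫ x, φ x ∂(eulerSeq κ g N h f j) =
      h * rateFun (fun x y => min (κ x y) N) (fun x => min (g x) N) φ
        (eulerSeq κ g N h f j) := by
  have hc : 0 ≤ c := by simpa using (abs_nonneg _).trans (hφ 0)
  have hθ : 1 ≤ θ := by linarith [H.two_lt]
  have := hf.isFiniteMeasure
  rw [eulerSeq_succ]
  set μ := eulerSeq κ g N h f j
  refine (H.bounded hN).integral_eulerStep hh hA hφc (hf.integrable_of_linear_growth hθ hφc hφ)
    (hf.integrable_of_linear_growth hθ (c := c) (by fun_prop) fun x => ?_) ?_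
  · refine (hφ _).trans ?_
    rw [abs_div, abs_two]
    gcongr
    linarith [abs_nonneg x]
  · have hi : Integrable (fun x : ℝ => c * (1 + |x|)) μ :=
      hf.integrable_of_linear_growth hθ (c := c) (by fun_prop) fun x => by
        rw [abs_of_nonneg (by positivity)]
    refine ((hi.comp_fst μ).add (hi.comp_snd μ)).mono'
      (Continuous.aestronglyMeasurable (by fun_prop)) (Eventually.of_forall fun q => ?_)
    refine (hφ _).trans ?_
    simp only [Pi.add_apply]
    rw [← mul_add]
    refine mul_le_mul_of_nonneg_left ?_ hc
    linarith [abs_add_le q.1 q.2]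

theorem exists_solution (H : Rates κ g C p θ) (hf : SizeBound θ B f) :
    ∃ (F : ℝ → Measure ℝ) (M : ℝ), F 0 = f ∧ 0 ≤ M ∧
      (∀ t, 0 ≤ t → SizeBound θ (2 * (B * Real.exp (M * t))) (F t)) ∧
      ∀ φ : ℝ → ℝ, Continuous φ → (∃ c, ∀ x, |φ x| ≤ c * (1 + |x|)) →
        ContinuousOn (fun t => ∫ x, φ x ∂(F t)) (Set.Ici 0) ∧
        ∀ t, 0 ≤ t → (∫ x, φ x ∂(F t)) - (∫ x, φ x ∂f) =
          ∫ s in (0 : ℝ)..t, rateFun κ g φ (F s) := by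
  have hC := H.const_nonneg
  have hB := hf.nonneg
  have hθ := H.two_lt
  have hfm : ∫⁻ x, ENNReal.ofReal |x| ∂f ≤ ENNReal.ofReal B := by
    refine (lintegral_mono fun x => ENNReal.ofReal_le_ofReal ?_).trans hf.mom
    simpa using rpow_le_momentWeight zero_le_one (by linarith : 1 ≤ θ) x
  obtain ⟨M, hM⟩ : ∃ M, M = C * (2 * 3 ^ θ * B + 1) := ⟨_, rfl⟩
  have hM0 : 0 ≤ M := by rw [hM]; positivity
  let h : ℕ → ℝ := fun n => 1 / ((n + 1) * (B * Real.exp (M * n) + 1))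
  have hpos : ∀ n, 0 < h n := fun n => by positivity
  have hA : ∀ n : ℕ, h n * (n * (B * Real.exp (M * n)) + n) ≤ 1 := fun n => by
    simp only [h]
    rw [one_div, inv_mul_le_iff₀ (by positivity), mul_one]
    have : 0 ≤ B * Real.exp (M * n) := by positivity
    linarith
  let U : Ultrafilter ℕ := hyperfilter ℕ
  have hU : (U : Filter ℕ) ≤ atTop := Nat.hyperfilter_le_atTop
  have hlim : Tendsto h U (𝓝 0) := by
    refine (squeeze_zero (fun n => (hpos n).le) (fun n => ?_)
      tendsto_one_div_add_atTop_nhds_zero_nat).mono_left hU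
    have : 0 ≤ B * Real.exp (M * n) := by positivity
    simp only [h]
    gcongr
    exact le_mul_of_one_le_right (by positivity) (by linarith)
  have hNat : Tendsto (fun n : ℕ => (n : ℝ)) U atTop :=
    tendsto_natCast_atTop_atTop.mono_left hU
  have hseq : ∀ (n j : ℕ), j * h n ≤ n →
      SizeBound θ (B * Real.exp (M * (j * h n))) (eulerSeq κ g n (h n) f j) := fun n j hj =>
    (H.sizeBound_eulerSeq n.cast_nonneg (hpos n).le hB hf hfm hM (hA n) j hj).1
  have hstep : ∀ φ : ℝ → ℝ, Continuous φ → ∀ c, (∀ x, |φ x| ≤ c * (1 + |x|)) →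
      ∀ n j : ℕ, j * h n ≤ n →
      (∫ x, φ x ∂(eulerSeq κ g n (h n) f (j + 1))) - ∫ x, φ x ∂(eulerSeq κ g n (h n) f j) =
      h n * rateFun (fun x y => min (κ x y) n) (fun x => min (g x) n) φ
        (eulerSeq κ g n (h n) f j) := fun φ hφc c hφ n j hj =>
    H.integral_eulerSeq_succ n.cast_nonneg (hpos n).le (hseq n j hj)
      (step_admissible hM0 n.cast_nonneg (hpos n).le (hA n) hB hj (hseq n j hj)) hφc hφ
  let Fn : ℕ → ℝ → Measure ℝ := fun n t => eulerSeq κ g n (h n) f ⌊t / h n⌋₊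
  have hfl : ∀ (n : ℕ) (t : ℝ), 0 ≤ t → (⌊t / h n⌋₊ : ℝ) * h n ≤ t := fun n t ht =>
    (le_div_iff₀ (hpos n)).1 (Nat.floor_le (div_nonneg ht (hpos n).le))
  have hFn : ∀ (n : ℕ) (t : ℝ), 0 ≤ t → t ≤ n → SizeBound θ (B * Real.exp (M * t)) (Fn n t) :=
    fun n t ht htn => (hseq n _ ((hfl n t ht).trans htn)).mono (by gcongr; exact hfl n t ht)
  have hex : ∀ t : ℝ, ∃ ν, (t = 0 → ν = f) ∧ (0 ≤ t →
      SizeBound θ (2 * (B * Real.exp (M * t))) ν ∧ VagueTendsto U (fun n => Fn n t) ν) := by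
    intro t
    rcases eq_or_ne t 0 with rfl | ht0
    · refine ⟨f, fun _ => rfl, fun _ => ⟨hf.mono (by simp; linarith), fun φ _ _ => ?_⟩⟩
      simp [Fn, eulerSeq]
    · by_cases ht : 0 ≤ t
      · obtain ⟨ν, h1, h2⟩ := exists_vague_limit U (by linarith : 1 ≤ θ)
          ((hNat.eventually_ge_atTop t).mono fun n hn => hFn n t ht hn)
        exact ⟨ν, fun h => absurd h ht0, fun _ => ⟨h1, h2⟩⟩
      · exact ⟨0, fun h => absurd h ht0, fun h => absurd h ht⟩
  choose F hF0 hF using hex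
  have hLnhds : ∀ t : ℝ, 0 ≤ t → ∀ᶠ q : ℕ × ℝ in (U : Filter ℕ) ×ˢ 𝓝[Set.Ici 0] t,
      0 ≤ q.2 ∧ q.2 ≤ t + 1 ∧ t + 1 ≤ q.1 := fun t ht => by
    have h1 : ∀ᶠ s in 𝓝[Set.Ici 0] t, 0 ≤ s ∧ s ≤ t + 1 := by
      filter_upwards [self_mem_nhdsWithin,
        mem_nhdsWithin_of_mem_nhds (Iic_mem_nhds (lt_add_one t))] with s hs hs'
      exact ⟨hs, hs'⟩
    exact ((hNat.eventually_ge_atTop (t + 1)).prod_mk h1).mono fun q hq => ⟨hq.2.1, hq.2.2, hq.1⟩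
  have hjsize : ∀ t : ℝ, 0 ≤ t → ∀ᶠ q : ℕ × ℝ in (U : Filter ℕ) ×ˢ 𝓝[Set.Ici 0] t,
      SizeBound θ (2 * (B * Real.exp (M * (t + 1)))) (Fn q.1 q.2) := fun t ht => by
    filter_upwards [hLnhds t ht] with q ⟨h0, h1, h2⟩
    refine (hFn q.1 q.2 h0 (h1.trans h2)).mono ?_
    have : B * Real.exp (M * q.2) ≤ B * Real.exp (M * (t + 1)) := by gcongr
    have : 0 ≤ B * Real.exp (M * q.2) := by positivity
    linarith
  have hFsize : ∀ t : ℝ, 0 ≤ t → SizeBound θ (2 * (B * Real.exp (M * (t + 1)))) (F t) :=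
    fun t ht => ((hF t ht).1).mono (by gcongr; linarith)
  have hjoint : ∀ t : ℝ, 0 ≤ t →
      VagueTendsto ((U : Filter ℕ) ×ˢ 𝓝[Set.Ici 0] t) (fun q => Fn q.1 q.2) (F t) := by
    intro t ht φ hφc hφs
    obtain ⟨c, hc⟩ := hφs.exists_bound_of_continuous hφc
    have hc0 : 0 ≤ c := (norm_nonneg _).trans (hc 0)
    have hφ : ∀ x, |φ x| ≤ c * (1 + |x|) := fun x =>
      (hc x).trans (le_mul_of_one_le_right hc0 (by linarith [abs_nonneg x]))
    set B' := B * Real.exp (M * (t + 1))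
    have hB' : 0 ≤ B' := by positivity
    set L := 24 * c * C * B' * B' + 3 * c * C * B'
    have hLip : ∀ (n : ℕ) (s s' : ℝ), 0 ≤ s → s ≤ s' → s' ≤ t + 1 → t + 1 ≤ n →
        |(∫ x, φ x ∂(Fn n s')) - ∫ x, φ x ∂(Fn n s)| ≤ L * (s' - s + h n) := by
      intro n s s' hs hss hs' hn
      have := abs_sub_le_of_euler (u := fun j => ∫ x, φ x ∂(eulerSeq κ g n (h n) f j))
        (r := fun j => rateFun (fun x y => min (κ x y) n) (fun x => min (g x) n) φ
          (eulerSeq κ g n (h n) f j)) (ρ := 0) (c := L) (hpos n) hs hss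
        (fun j hj => hstep φ hφc c hφ n j (hj.trans (hs'.trans hn))) (fun σ hσ => by
          have hσ0 := hs.trans hσ.1
          have hσ1 := hσ.2.trans hs'
          have HB := H.bounded (n.cast_nonneg (α := ℝ))
          rw [sub_zero]
          exact H.abs_rateFun_le ((hFn n σ hσ0 (hσ1.trans hn)).mono
            (show B * Real.exp (M * σ) ≤ B * Real.exp (M * (t + 1)) by gcongr))
            HB.coag_nonneg (fun _ _ => min_le_left _ _) HB.frag_nonneg
            (fun _ => min_le_left _ _) hφ)
      simpa using this
    have hpt := (hF t ht).2 φ hφc hφs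
    rw [tendsto_iff_dist_tendsto_zero] at hpt ⊢
    have hup : Tendsto (fun q : ℕ × ℝ => L * (|q.2 - t| + h q.1) +
        dist (∫ x, φ x ∂(Fn q.1 t)) (∫ x, φ x ∂(F t))) ((U : Filter ℕ) ×ˢ 𝓝[Set.Ici 0] t)
        (𝓝 (L * (|t - t| + 0) + 0)) := by
      have e1 : Tendsto (fun q : ℕ × ℝ => q.2) ((U : Filter ℕ) ×ˢ 𝓝[Set.Ici 0] t) (𝓝 t) :=
        tendsto_snd.mono_right nhdsWithin_le_nhds
      exact (((e1.sub_const t).abs.add (hlim.comp tendsto_fst)).const_mul L).add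
        (hpt.comp tendsto_fst)
    simp only [sub_self, abs_zero, add_zero, mul_zero] at hup
    refine squeeze_zero' (Eventually.of_forall fun _ => dist_nonneg) ?_ hup
    filter_upwards [hLnhds t ht] with q ⟨h0, h1, h2⟩
    refine (dist_triangle _ (∫ x, φ x ∂(Fn q.1 t)) _).trans ?_
    gcongr
    rw [Real.dist_eq]
    rcases le_total t q.2 with hle | hle
    · rw [abs_of_nonneg (sub_nonneg.2 hle)]
      exact hLip q.1 t q.2 ht hle h1 h2
    · rw [abs_sub_comm, abs_sub_comm q.2 t, abs_of_nonneg (sub_nonneg.2 hle)]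
      exact hLip q.1 q.2 t h0 hle (by linarith) h2
  refine ⟨F, M, hF0 0 rfl, hM0, fun t ht => (hF t ht).1, fun φ hφc ⟨c, hφ⟩ => ?_⟩
  have hc : 0 ≤ c := by simpa using (abs_nonneg _).trans (hφ 0)
  have main := integral_eq_of_tendsto_euler hpos hlim
    (u := fun n j => ∫ x, φ x ∂(eulerSeq κ g n (h n) f j))
    (r := fun n j => rateFun (fun x y => min (κ x y) n) (fun x => min (g x) n) φ
      (eulerSeq κ g n (h n) f j))
    (G := fun t => ∫ x, φ x ∂(F t)) (ρ := fun t => rateFun κ g φ (F t))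
    (fun T => (hNat.eventually_ge_atTop T).mono fun n hn j hj =>
      hstep φ hφc c hφ n j (hj.trans hn))
    (fun t ht => ?_)
    (fun t ht => H.tendsto_rateFun (hjsize t ht) (hFsize t ht) (hjoint t ht)
      (hNat.comp tendsto_fst) hφc hφ)
  · simpa only [hF0 0 rfl] using main
  · refine tendsto_integral_of_vague (by linarith) (hjsize t ht) (hFsize t ht) (hjoint t ht) hφc
      fun ε hε => ?_
    obtain ⟨R, hR1, hR⟩ := exists_rpow_le_momentWeight (show 1 < θ by linarith)
      (show 0 < ε / (2 * c + 1) by positivity)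
    refine ⟨R, fun x hx => ?_⟩
    have h1 := hR x hx
    rw [Real.rpow_one] at h1
    have w0 := momentWeight_pos θ x
    calc _ ≤ c * (1 + |x|) := hφ x
      _ ≤ c * (2 * |x|) := by gcongr; linarith
      _ = 2 * c * |x| := by ring
      _ ≤ (2 * c + 1) * (ε / (2 * c + 1) * momentWeight θ x) := by gcongr; linarith
      _ = _ := by field_simp

end Rates

lemma two_zpow_eq_ofReal (n : ℤ) : (2 : ENNReal) ^ n = ENNReal.ofReal ((2 : ℝ) ^ n) := by
  have h := ENNReal.coe_zpow (two_ne_zero (α := NNReal)) n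
  rw [ENNReal.coe_ofNat] at h
  rw [← h, ← ENNReal.ofReal_coe_nnreal]
  simp

lemma measure_dyadic_le {μ : Measure ℝ} {A : ℝ} (hA : Mnorm μ ≤ ENNReal.ofReal A) {n : ℤ}
    (hn : n < 0) :
    μ (Set.Ico ((2 : ℝ) ^ n) ((2 : ℝ) ^ (n + 1))) ≤ ENNReal.ofReal (A * 2 ^ n) := by
  have h1 : (2 : ENNReal) ^ (-n) * μ (Set.Ico ((2 : ℝ) ^ n) ((2 : ℝ) ^ (n + 1))) ≤
      ENNReal.ofReal A :=
    ((le_iSup (fun n : {m : ℤ // m < 0} => (2 : ENNReal) ^ (-n.1) *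
      μ (Set.Ico ((2 : ℝ) ^ n.1) ((2 : ℝ) ^ (n.1 + 1)))) ⟨n, hn⟩).trans le_self_add).trans hA
  rw [mul_comm A, ENNReal.ofReal_mul (by positivity), ← two_zpow_eq_ofReal]
  refine le_trans (le_of_eq ?_) (mul_le_mul_right h1 ((2 : ENNReal) ^ n))
  rw [← mul_assoc, ← ENNReal.zpow_add (by simp) (by simp), add_neg_cancel, zpow_zero, one_mul]

lemma measure_Iio_two_zpow_le {μ : Measure ℝ} {A : ℝ} (hA : Mnorm μ ≤ ENNReal.ofReal A)
    (hA0 : 0 ≤ A) (hμ : μ (Set.Ioi 0)ᶜ = 0) {m : ℤ} (hm : m ≤ 0) :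
    μ (Set.Iio ((2 : ℝ) ^ m)) ≤ ENNReal.ofReal (A * 2 ^ m) := by
  have hsub : Set.Iio ((2 : ℝ) ^ m) ⊆ (Set.Ioi 0)ᶜ ∪
      ⋃ i : ℕ, Set.Ico ((2 : ℝ) ^ (m - 1 - i)) ((2 : ℝ) ^ (m - 1 - i + 1)) := by
    intro x hx
    rcases le_or_gt x 0 with h0 | h0
    · exact Or.inl (by simpa using h0)
    obtain ⟨n, hn⟩ := exists_mem_Ico_zpow h0 one_lt_two
    have hnm : n < m := (zpow_lt_zpow_iff_right₀ (one_lt_two (α := ℝ))).1 (hn.1.trans_lt hx)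
    refine Or.inr (Set.mem_iUnion.2 ⟨(m - 1 - n).toNat, ?_⟩)
    rwa [Int.toNat_of_nonneg (by lia), sub_sub_cancel]
  have hsum := hasSum_geometric_two' (A * 2 ^ m)
  calc μ (Set.Iio ((2 : ℝ) ^ m))
      ≤ μ (Set.Ioi 0)ᶜ + ∑' i : ℕ, μ (Set.Ico ((2 : ℝ) ^ (m - 1 - i))
          ((2 : ℝ) ^ (m - 1 - i + 1))) :=
        (measure_mono hsub).trans ((measure_union_le _ _).trans
          (by gcongr; exact measure_iUnion_le _))
    _ ≤ ∑' i : ℕ, ENNReal.ofReal (A * 2 ^ m / 2 / 2 ^ i) := by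
        rw [hμ, zero_add]
        refine ENNReal.tsum_le_tsum fun i => (measure_dyadic_le hA (by lia)).trans_eq ?_
        rw [zpow_sub₀ two_ne_zero, zpow_sub₀ two_ne_zero, zpow_one, zpow_natCast, mul_div_assoc,
          mul_div_assoc]
    _ = ENNReal.ofReal (A * 2 ^ m) := by
        rw [← ENNReal.ofReal_tsum_of_nonneg (fun i => by positivity) hsum.summable, hsum.tsum_eq]

lemma exists_sizeBound {μ : Measure ℝ} {θ : ℝ} (hμ : μ (Set.Ioi 0)ᶜ = 0) (hnorm : Mnorm μ ≠ ⊤)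
    (hmom : (∫⁻ ξ in Set.Ioi (0 : ℝ), ENNReal.ofReal (ξ ^ θ) ∂μ) ≠ ⊤) :
    ∃ B, SizeBound θ B μ := by
  obtain ⟨A, hA0, hA⟩ : ∃ A, 0 ≤ A ∧ Mnorm μ ≤ ENNReal.ofReal A :=
    ⟨_, ENNReal.toReal_nonneg, (ENNReal.ofReal_toReal hnorm).ge⟩
  obtain ⟨D, hD0, hD⟩ : ∃ D, 0 ≤ D ∧
      (∫⁻ ξ in Set.Ioi (0 : ℝ), ENNReal.ofReal (ξ ^ θ) ∂μ) ≤ ENNReal.ofReal D :=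
    ⟨_, ENNReal.toReal_nonneg, (ENNReal.ofReal_toReal hmom).ge⟩
  have hpos : ∀ᵐ x ∂μ, x ∈ Set.Ioi (0 : ℝ) := hμ
  have huniv : μ Set.univ ≤ ENNReal.ofReal (2 * A) := by
    rw [two_mul, ENNReal.ofReal_add hA0 hA0, ← Set.Iio_union_Ici (a := (1 : ℝ))]
    refine (measure_union_le _ _).trans (add_le_add ?_ (le_add_self.trans hA))
    simpa using measure_Iio_two_zpow_le hA hA0 hμ le_rfl
  refine ⟨2 * A + D, by positivity, ?_, fun R hR => ?_⟩
  · rw [ENNReal.ofReal_add (by positivity) hD0]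
    calc ∫⁻ x, ENNReal.ofReal (momentWeight θ x) ∂μ
        = ∫⁻ x, (1 + ENNReal.ofReal (|x| ^ θ)) ∂μ := by
          refine lintegral_congr fun x => ?_
          rw [momentWeight, ENNReal.ofReal_add zero_le_one (by positivity), ENNReal.ofReal_one]
      _ = μ Set.univ + ∫⁻ x in Set.Ioi (0 : ℝ), ENNReal.ofReal (x ^ θ) ∂μ := by
          rw [lintegral_add_left measurable_const, lintegral_one,
            Measure.restrict_eq_self_of_ae_mem hpos]
          congr 1
          refine lintegral_congr_ae (hpos.mono fun x hx => ?_)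
          simp only [abs_of_pos (Set.mem_Ioi.1 hx)]
      _ ≤ _ := add_le_add huniv hD
  · rcases le_or_gt 1 R with h1 | h1
    · refine ((measure_mono (Set.subset_univ _)).trans huniv).trans
        (ENNReal.ofReal_le_ofReal ?_)
      nlinarith
    · obtain ⟨n, hn⟩ := exists_mem_Ico_zpow hR one_lt_two
      have hn0 : n < 0 := (zpow_lt_one_iff_right₀ (one_lt_two (α := ℝ))).1 (hn.1.trans_lt h1)
      refine ((measure_mono (Set.Iic_subset_Iio.2 hn.2)).trans
        (measure_Iio_two_zpow_le hA hA0 hμ (by lia))).trans (ENNReal.ofReal_le_ofReal ?_)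
      rw [zpow_add_one₀ two_ne_zero]
      nlinarith [mul_le_mul_of_nonneg_left hn.1 hA0, mul_nonneg hD0 hR.le]

lemma SizeBound.mnorm_le {μ : Measure ℝ} {θ B : ℝ} (h : SizeBound θ B μ) :
    Mnorm μ ≤ ENNReal.ofReal (3 * B) := by
  have hB := h.nonneg
  rw [show 3 * B = 2 * B + B by ring, ENNReal.ofReal_add (by positivity) hB]
  refine add_le_add (iSup_le fun n => ?_)
    ((measure_mono (Set.subset_univ _)).trans h.measure_univ_le)
  calc _ ≤ (2 : ENNReal) ^ (-n.1) * ENNReal.ofReal (B * 2 ^ (n.1 + 1)) := by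
        gcongr
        exact (measure_mono (Set.Ico_subset_Iio_self.trans Set.Iio_subset_Iic_self)).trans
          (h.small _ (by positivity))
    _ = ENNReal.ofReal (2 * B) := by
        rw [two_zpow_eq_ofReal, ← ENNReal.ofReal_mul (by positivity), zpow_neg,
          zpow_add_one₀ two_ne_zero]
        congr 1
        field_simp

lemma SizeBound.lintegral_rpow_le {μ : Measure ℝ} {θ B : ℝ} (h : SizeBound θ B μ) :
    ∫⁻ x in Set.Ioi (0 : ℝ), ENNReal.ofReal (x ^ θ) ∂μ ≤ ENNReal.ofReal B := by
  rw [h.restrict_Ioi]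
  refine (lintegral_mono_ae (h.ae_pos.mono fun x hx => ENNReal.ofReal_le_ofReal ?_)).trans h.mom
  rw [momentWeight, abs_of_pos hx]
  linarith

lemma exists_le_momentWeight {u : ℝ → ℝ} {a : ℝ} (hu : ContinuousOn u (Set.Ici 0))
    (hlim : Tendsto (fun x => u x / x ^ a) atTop (𝓝 1)) :
    ∃ C, 0 ≤ C ∧ ∀ x, 0 ≤ x → u x ≤ C * momentWeight a x := by
  obtain ⟨R, hR⟩ := eventually_atTop.1 (hlim.eventually (eventually_le_nhds one_lt_two))
  obtain ⟨c, hc⟩ := (isCompact_Icc (a := (0 : ℝ)) (b := max R 1)).exists_bound_of_continuousOn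
    (hu.mono Set.Icc_subset_Ici_self)
  have hc0 : 0 ≤ c := (norm_nonneg _).trans (hc 0 ⟨le_rfl, by positivity⟩)
  refine ⟨c + 2, by positivity, fun x hx => ?_⟩
  have h1 := one_le_momentWeight a x
  rcases le_or_gt x (max R 1) with hxR | hxR
  · nlinarith [(le_abs_self _).trans (hc x ⟨hx, hxR⟩)]
  · have hx0 : 0 < x := by linarith [le_max_right R 1]
    have h2 := hR x (by linarith [le_max_left R 1])
    have h3 : 0 < x ^ a := Real.rpow_pos_of_pos hx0 a
    rw [div_le_iff₀ h3] at h2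
    have h4 : x ^ a ≤ momentWeight a x := by rw [momentWeight, abs_of_nonneg hx]; linarith
    nlinarith

/-- The fragmentation rate `γ`, extended to `(-∞, 0]` by its limit at `0`. -/
def fragExt (γ₀ : ℝ) (γ : ℝ → ℝ) (x : ℝ) : ℝ := if 0 < x then γ x else γ₀

lemma fragExt_of_pos {γ₀ : ℝ} {γ : ℝ → ℝ} {x : ℝ} (hx : 0 < x) : fragExt γ₀ γ x = γ x :=
  if_pos hx

lemma fragExt_of_nonpos {γ₀ : ℝ} {γ : ℝ → ℝ} {x : ℝ} (hx : x ≤ 0) : fragExt γ₀ γ x = γ₀ :=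
  if_neg hx.not_gt

lemma continuous_fragExt {γ₀ : ℝ} {γ : ℝ → ℝ} (hγ : ContinuousOn γ (Set.Ioi 0))
    (h0 : Tendsto γ (𝓝[>] 0) (𝓝 γ₀)) : Continuous (fragExt γ₀ γ) := by
  refine continuous_iff_continuousAt.2 fun x => ?_
  rcases lt_trichotomy x 0 with hx | rfl | hx
  · refine (continuousAt_const (y := γ₀)).congr ?_
    filter_upwards [Iio_mem_nhds hx] with y hy using (fragExt_of_nonpos (le_of_lt hy)).symm
  · refine continuousAt_iff_continuous_left'_right'.2 ⟨?_, ?_⟩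
    · exact (continuousWithinAt_const (b := γ₀)).congr
        (fun y hy => fragExt_of_nonpos (le_of_lt hy))
        (fragExt_of_nonpos le_rfl)
    · rw [ContinuousWithinAt, fragExt_of_nonpos le_rfl]
      refine h0.congr' ?_
      filter_upwards [self_mem_nhdsWithin] with y hy using (fragExt_of_pos hy).symm
  · refine (hγ.continuousAt (Ioi_mem_nhds hx)).congr ?_
    filter_upwards [Ioi_mem_nhds hx] with y hy using (fragExt_of_pos hy).symm

/-- The coagulation kernel, restricted to the open quadrant. -/
def coagExt (k Q : ℝ → ℝ) (x y : ℝ) : ℝ :=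
  (Set.Ioi 0 ×ˢ Set.Ioi 0).indicator (Function.uncurry (Kker k Q)) (x, y)

lemma coagExt_of_pos {k Q : ℝ → ℝ} {x y : ℝ} (hx : 0 < x) (hy : 0 < y) :
    coagExt k Q x y = Kker k Q x y :=
  Set.indicator_of_mem (Set.mk_mem_prod (s := Set.Ioi 0) (t := Set.Ioi 0) hx hy) _

lemma pos_of_coagExt_ne_zero {k Q : ℝ → ℝ} {x y : ℝ} (h : coagExt k Q x y ≠ 0) :
    0 < x ∧ 0 < y :=
  Set.mem_of_indicator_ne_zero (s := Set.Ioi 0 ×ˢ Set.Ioi 0) (a := (x, y)) h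

lemma continuousOn_uncurry_Kker {k Q : ℝ → ℝ} (hk : ContinuousOn k (Set.Ici 0))
    (hQ : Continuous Q) :
    ContinuousOn (Function.uncurry (Kker k Q)) (Set.Ioi 0 ×ˢ Set.Ioi 0) := by
  have hadd : ContinuousOn (fun q : ℝ × ℝ => q.1 + q.2) (Set.Ioi 0 ×ˢ Set.Ioi 0) := by fun_prop
  have hne : ∀ q ∈ Set.Ioi (0 : ℝ) ×ˢ Set.Ioi (0 : ℝ), q.1 + q.2 ≠ 0 := fun q hq =>
    (add_pos (Set.mem_Ioi.1 hq.1) (Set.mem_Ioi.1 hq.2)).ne'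
  refine ((hadd.inv₀ hne).mul (hk.comp (hadd.div_const 2) fun q hq => ?_)).mul
    (hQ.comp_continuousOn (((continuousOn_const.mul continuousOn_snd).div hadd hne).sub
      continuousOn_const))
  exact div_nonneg (add_pos (Set.mem_Ioi.1 hq.1) (Set.mem_Ioi.1 hq.2)).le zero_le_two

lemma Kker_symm {k Q : ℝ → ℝ} (hQ : ∀ x, Q (-x) = Q x) {x y : ℝ} (h : x + y ≠ 0) :
    Kker k Q x y = Kker k Q y x := by
  unfold Kker
  rw [← hQ, add_comm y x]
  congr 2
  field_simp
  ring

lemma comparable_of_Kker_ne_zero {k Q : ℝ → ℝ}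
    (hQ : tsupport Q ⊆ Set.Ioo (-(1 / 3) : ℝ) (1 / 3)) {x y : ℝ} (hx : 0 < x) (hy : 0 < y)
    (h : Kker k Q x y ≠ 0) : x ≤ 2 * y ∧ y ≤ 2 * x := by
  have h1 := hQ (subset_tsupport Q (right_ne_zero_of_mul h))
  have hs : 0 < x + y := add_pos hx hy
  have e : 2 * y / (x + y) - 1 = (y - x) / (x + y) := by field_simp; ring
  rw [e, Set.mem_Ioo, lt_div_iff₀ hs, div_lt_iff₀ hs] at h1
  constructor <;> linarith [h1.1, h1.2]

lemma exists_rates {α β θ γ₀ : ℝ} {k γ Q : ℝ → ℝ} (hα : α + 1 ≤ 2) (hα0 : 0 ≤ α + 1)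
    (hβ : 1 ≤ β) (hθ : β + 1 < θ) (hγ₀ : 0 ≤ γ₀)
    (hk : ContinuousOn k (Set.Ici 0)) (hk_pos : ∀ x, 0 ≤ x → 0 ≤ k x)
    (hk_inf : Tendsto (fun x => k x / x ^ (α + 1)) atTop (𝓝 1))
    (hγ : ContinuousOn γ (Set.Ioi 0)) (hγ_pos : ∀ x, 0 < x → 0 ≤ γ x)
    (hγ_inf : Tendsto (fun x => γ x / x ^ β) atTop (𝓝 1))
    (hγ_zero : Tendsto γ (𝓝[>] 0) (𝓝 γ₀))
    (hQc : Continuous Q) (hQpos : ∀ x, 0 ≤ Q x)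
    (hQsupp : tsupport Q ⊆ Set.Ioo (-(1 / 3) : ℝ) (1 / 3)) (hQeven : ∀ x, Q (-x) = Q x) :
    ∃ C, Rates (coagExt k Q) (fragExt γ₀ γ) C β θ := by
  have hg := continuous_fragExt hγ hγ_zero
  obtain ⟨a, ha0, ha⟩ := exists_le_momentWeight hk hk_inf
  obtain ⟨b, hb0, hb⟩ := exists_le_momentWeight (a := β) hg.continuousOn (hγ_inf.congr' (by
    filter_upwards [eventually_gt_atTop 0] with x hx
    rw [fragExt_of_pos hx]))
  have hQcs : HasCompactSupport Q :=
    (isCompact_Icc (a := (-(1 / 3) : ℝ)) (b := 1 / 3)).of_isClosed_subset (isClosed_tsupport Q)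
      (hQsupp.trans Set.Ioo_subset_Icc_self)
  obtain ⟨q, hq⟩ := hQcs.exists_bound_of_continuous hQc
  have hq0 : 0 ≤ q := (norm_nonneg _).trans (hq 0)
  have hfz : ∀ x, x ≤ 0 → fragExt γ₀ γ x ≤ b := fun x hx => by
    have := hb 0 le_rfl
    rw [fragExt_of_nonpos le_rfl, momentWeight, abs_zero, Real.zero_rpow (by linarith)] at this
    rw [fragExt_of_nonpos hx]
    linarith
  have hb1 : b ≤ b * (1 + 2 ^ β) := le_mul_of_one_le_right hb0 (by
    linarith [Real.rpow_nonneg (zero_le_two (α := ℝ)) β])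
  have haq : 0 ≤ 2 * a * q := by positivity
  refine ⟨2 * a * q + b * (1 + 2 ^ β), ?_⟩
  have hcoag : ∀ x y, coagExt k Q x y ≠ 0 → 0 < x ∧ x ≤ 2 * y ∧ y ≤ 2 * x := fun x y h => by
    obtain ⟨hx, hy⟩ := pos_of_coagExt_ne_zero h
    rw [coagExt_of_pos hx hy] at h
    exact ⟨hx, comparable_of_Kker_ne_zero hQsupp hx hy h⟩
  exact
  { const_nonneg := by positivity
    one_le := hβ
    lt := hθ
    meas_coag := by
      have := (continuousOn_uncurry_Kker hk hQc).measurable_piecewise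
        (g := 0) (continuousOn_const (c := (0 : ℝ)) (s := (Set.Ioi (0 : ℝ) ×ˢ Set.Ioi (0 : ℝ))ᶜ))
        (measurableSet_Ioi.prod measurableSet_Ioi)
      rwa [Set.piecewise_eq_indicator] at this
    cont_coag := (continuousOn_uncurry_Kker hk hQc).congr fun q hq => coagExt_of_pos hq.1 hq.2
    coag_nonneg := fun x y => Set.indicator_nonneg (fun q hq => by
      have hs := add_pos (Set.mem_Ioi.1 hq.1) (Set.mem_Ioi.1 hq.2)
      exact mul_nonneg (mul_nonneg (inv_nonneg.2 hs.le) (hk_pos _ (by positivity))) (hQpos _)) _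
    coag_symm := fun x y => by
      by_cases h : 0 < x ∧ 0 < y
      · rw [coagExt_of_pos h.1 h.2, coagExt_of_pos h.2 h.1,
          Kker_symm hQeven (add_pos h.1 h.2).ne']
      · rw [by_contra fun h' => h (pos_of_coagExt_ne_zero (k := k) (Q := Q) h'),
          by_contra fun h' => h (pos_of_coagExt_ne_zero (k := k) (Q := Q) (x := y) h').symm]
    coag_supp := hcoag
    coag_le := fun x y hx => by
      have hR : 0 ≤ x⁻¹ + x := by positivity
      by_cases h : coagExt k Q x y = 0
      · rw [h]; positivity
      obtain ⟨-, hxy, hyx⟩ := hcoag x y h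
      have hy : 0 < y := by linarith
      rw [coagExt_of_pos hx hy]
      have hs : 0 < x + y := by positivity
      have hk1 : k ((x + y) / 2) ≤ a * (2 * (1 + ((x + y) / 2) ^ 2)) := by
        refine (ha _ (by positivity)).trans (mul_le_mul_of_nonneg_left ?_ ha0)
        have := rpow_le_momentWeight hα0 hα ((x + y) / 2)
        simp only [momentWeight, Real.rpow_two, sq_abs] at this ⊢
        nlinarith [sq_nonneg ((x + y) / 2)]
      calc Kker k Q x y ≤ (x + y)⁻¹ * (a * (2 * (1 + ((x + y) / 2) ^ 2))) * q := by
            unfold Kker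
            have hk0 := hk_pos ((x + y) / 2) (by positivity)
            have hQ0 := hQpos (2 * y / (x + y) - 1)
            have hQq := (le_abs_self _).trans (hq (2 * y / (x + y) - 1))
            gcongr
        _ = 2 * a * q * ((x + y)⁻¹ + (x + y) / 4) := by field_simp; ring
        _ ≤ 2 * a * q * (x⁻¹ + x) := by
            gcongr
            · linarith
            · linarith
        _ ≤ _ := by gcongr; linarith
    cont_frag := hg
    frag_nonneg := fun x => by
      rcases le_or_gt x 0 with hx | hx
      · rwa [fragExt_of_nonpos hx]
      · rw [fragExt_of_pos hx]; exact hγ_pos x hx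
    frag_le := fun x => by
      have hw : 0 ≤ |x| ^ β := by positivity
      refine le_trans ?_ (mul_le_mul_of_nonneg_right
        (show b ≤ 2 * a * q + b * (1 + 2 ^ β) by linarith) (by positivity))
      rcases le_or_gt x 0 with hx | hx
      · exact (hfz x hx).trans (le_mul_of_one_le_right hb0 (by linarith))
      · exact hb x hx.le
    frag_le_of_le := fun x hx2 => by
      refine le_trans ?_ (le_add_of_nonneg_left haq)
      rcases le_or_gt x 0 with hx | hx
      · exact (hfz x hx).trans hb1
      · refine (hb x hx.le).trans (mul_le_mul_of_nonneg_left ?_ hb0)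
        rw [momentWeight, abs_of_pos hx]
        gcongr }

lemma SizeBound.rateFun_ext {μ : Measure ℝ} {θ B γ₀ : ℝ} {k Q γ φ : ℝ → ℝ}
    (h : SizeBound θ B μ) :
    rateFun (coagExt k Q) (fragExt γ₀ γ) (fun x => φ (max x 0)) μ =
      1 / 2 * (∫ ξ in Set.Ioi (0 : ℝ), (∫ η in Set.Ioi (0 : ℝ),
          Kker k Q ξ η * (φ (ξ + η) - φ ξ - φ η) ∂μ) ∂μ) -
        1 / 4 * (∫ η in Set.Ioi (0 : ℝ), γ η * (φ η - 2 * φ (η / 2)) ∂μ) := by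
  rw [rateFun, h.restrict_Ioi]
  congr 2
  · refine integral_congr_ae (h.ae_pos.mono fun x hx => integral_congr_ae
      (h.ae_pos.mono fun y hy => ?_))
    simp only [coagExt_of_pos hx hy, max_eq_left hx.le, max_eq_left hy.le,
      max_eq_left (add_pos hx hy).le]
  · refine integral_congr_ae (h.ae_pos.mono fun x hx => ?_)
    simp only [fragExt_of_pos hx, max_eq_left hx.le, max_eq_left (half_pos hx).le]

lemma exists_linear_growth {φ : ℝ → ℝ} (hφ : ContinuousOn φ (Set.Ici 0)) {c : ℝ}
    (hc : ∀ x, 1 ≤ x → |φ x| ≤ c * x) : ∃ d, ∀ x, |φ (max x 0)| ≤ d * (1 + |x|) := by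
  obtain ⟨a, ha⟩ := (isCompact_Icc (a := (0 : ℝ)) (b := 1)).exists_bound_of_continuousOn
    (hφ.mono Set.Icc_subset_Ici_self)
  have ha0 : 0 ≤ a := (norm_nonneg _).trans (ha 0 ⟨le_rfl, zero_le_one⟩)
  have hc0 : 0 ≤ c := by simpa using (abs_nonneg _).trans (hc 1 le_rfl)
  refine ⟨a + c, fun x => ?_⟩
  have hx := abs_nonneg x
  rcases le_or_gt x 1 with h1 | h1
  · have := ha (max x 0) ⟨le_max_right _ _, max_le h1 zero_le_one⟩
    rw [Real.norm_eq_abs] at this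
    nlinarith
  · have := hc x h1.le
    rw [max_eq_left (by linarith), abs_of_pos (by linarith : 0 < x)]
    nlinarith

/-- existence of weak solutions to the coagulation–fragmentation equation.
If `f₀` is a positive Radon measure on `(0,∞)` with `‖f₀‖ < ∞` and a finite moment of order
`θ > β + 1`, then there is a global weak solution `t ↦ f(t)` of
`∂_t f = 𝒞[f] + ℱ[f]` (with `Γ(ξ,η) = γ(ξ)δ(ξ−2η)`) with initial datum `f₀`, conserving the
weak formulation against every continuous `φ` with `φ(ξ) = O(ξ)`, and with `‖f(t)‖` and the
`θ`-moment bounded on every compact time interval. -/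
theorem stmt19
    (α β αb βb k₀ γ₀ : ℝ)
    (hα : α ∈ Set.Ioo (0:ℝ) 1) (hβ : β ∈ Set.Ioo (1:ℝ) 2)
    (hαb : 1 < αb) (hβb : 1 < βb) (hk₀ : 0 < k₀) (hγ₀ : 0 < γ₀)
    (k γ : ℝ → ℝ)
    (hk_cont : ContinuousOn k (Set.Ici 0)) (hk_pos : ∀ ξ : ℝ, 0 ≤ ξ → 0 < k ξ)
    (hk_inf : Tendsto (fun ξ : ℝ => k ξ / ξ ^ (α + 1)) atTop (𝓝 1))
    (hk_0 : (fun ξ : ℝ => k ξ - k₀) =O[𝓝[>] 0] fun ξ : ℝ => ξ ^ αb)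
    (hγ_cont : ContinuousOn γ (Set.Ioi 0)) (hγ_pos : ∀ ξ : ℝ, 0 < ξ → 0 < γ ξ)
    (hγ_inf : Tendsto (fun ξ : ℝ => γ ξ / ξ ^ β) atTop (𝓝 1))
    (hγ_0 : (fun ξ : ℝ => γ ξ - γ₀) =O[𝓝[>] 0] fun ξ : ℝ => ξ ^ βb)
    (Q : ℝ → ℝ) (hQc : Continuous Q) (hQpos : ∀ x : ℝ, 0 ≤ Q x) (hQ0 : Q 0 = 1)
    (hQsupp : tsupport Q ⊆ Set.Ioo (-(1/3) : ℝ) (1/3)) (hQeven : ∀ x : ℝ, Q (-x) = Q x)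
    (θ : ℝ) (hθ : β + 1 < θ)
    (f0 : Measure ℝ)
    (hf0supp : f0 (Set.Ioi (0:ℝ))ᶜ = 0)
    (hf0norm : Mnorm f0 ≠ ⊤)
    (hf0mom : (∫⁻ ξ in Set.Ioi (0:ℝ), ENNReal.ofReal (ξ ^ θ) ∂f0) ≠ ⊤) :
    ∃ f : ℝ → Measure ℝ,
      f 0 = f0 ∧
      (∀ t : ℝ, 0 ≤ t → (f t) (Set.Ioi (0:ℝ))ᶜ = 0) ∧
      (∀ φ : ℝ → ℝ, ContinuousOn φ (Set.Ici 0) → (∃ c : ℝ, ∀ ξ : ℝ, 1 ≤ ξ → |φ ξ| ≤ c * ξ) →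
        ContinuousOn (fun t => ∫ ξ in Set.Ioi (0:ℝ), φ ξ ∂(f t)) (Set.Ici 0) ∧
        ∀ t : ℝ, 0 ≤ t →
          (∫ ξ in Set.Ioi (0:ℝ), φ ξ ∂(f t)) - (∫ ξ in Set.Ioi (0:ℝ), φ ξ ∂f0) =
            ∫ s in (0:ℝ)..t,
              (1 / 2 *
                  (∫ ξ in Set.Ioi (0:ℝ),
                    (∫ η in Set.Ioi (0:ℝ),
                      Kker k Q ξ η * (φ (ξ + η) - φ ξ - φ η) ∂(f s)) ∂(f s)) -
                1 / 4 *
                  (∫ η in Set.Ioi (0:ℝ), γ η * (φ η - 2 * φ (η / 2)) ∂(f s)))) ∧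
      ∀ T : ℝ, 0 < T → ∃ C : ℝ,
        ∀ t : ℝ, 0 ≤ t → t ≤ T →
          Mnorm (f t) ≤ ENNReal.ofReal C ∧
          (∫⁻ ξ in Set.Ioi (0:ℝ), ENNReal.ofReal (ξ ^ θ) ∂(f t)) ≤ ENNReal.ofReal C := by
  have hγ_zero : Tendsto γ (𝓝[>] 0) (𝓝 γ₀) := by
    have h1 : Tendsto (fun ξ : ℝ => ξ ^ βb) (𝓝[>] 0) (𝓝 0) := by
      have := (Real.continuousAt_rpow_const 0 βb (Or.inr (by linarith))).tendsto
      rw [Real.zero_rpow (by linarith)] at this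
      exact this.mono_left nhdsWithin_le_nhds
    simpa using (hγ_0.trans_tendsto h1).add_const γ₀
  obtain ⟨C, H⟩ := exists_rates (by linarith [hα.2]) (by linarith [hα.1]) hβ.1.le hθ hγ₀.le
    hk_cont
    (fun x hx => (hk_pos x hx).le) hk_inf hγ_cont (fun x hx => (hγ_pos x hx).le) hγ_inf hγ_zero
    hQc hQpos hQsupp hQeven
  obtain ⟨B, hB⟩ := exists_sizeBound hf0supp hf0norm hf0mom
  obtain ⟨f, M, hf0, hM, hsize, hsol⟩ := H.exists_solution hB
  have hint : ∀ {μ : Measure ℝ} {b : ℝ}, SizeBound θ b μ → ∀ φ : ℝ → ℝ,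
      ∫ ξ in Set.Ioi (0 : ℝ), φ ξ ∂μ = ∫ x, φ (max x 0) ∂μ := fun hμ φ => by
    rw [hμ.restrict_Ioi]
    exact integral_congr_ae (hμ.ae_pos.mono fun x hx => by simp only [max_eq_left hx.le])
  refine ⟨f, hf0, fun t ht => ?_, fun φ hφ ⟨c, hc⟩ => ?_, fun T _ => ?_⟩
  · rw [Set.compl_Ioi]
    exact (hsize t ht).measure_Iic_zero
  · have hφc : Continuous fun x => φ (max x 0) :=
      hφ.comp_continuous (by fun_prop) fun x => le_max_right x 0
    obtain ⟨h1, h2⟩ := hsol _ hφc (exists_linear_growth hφ hc)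
    refine ⟨h1.congr fun t ht => hint (hsize t ht) φ, fun t ht => ?_⟩
    rw [hint (hsize t ht), hint hB, h2 t ht]
    refine intervalIntegral.integral_congr fun s hs => ?_
    rw [Set.uIcc_of_le ht] at hs
    exact (hsize s hs.1).rateFun_ext
  · refine ⟨3 * (2 * (B * Real.exp (M * T))), fun t ht htT => ?_⟩
    have hB0 := hB.nonneg
    have h := (hsize t ht).mono (show _ ≤ 2 * (B * Real.exp (M * T)) by gcongr)
    refine ⟨h.mnorm_le, h.lintegral_rpow_le.trans (ENNReal.ofReal_le_ofReal ?_)⟩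
    have : 0 ≤ 2 * (B * Real.exp (M * T)) := by positivity
    linarith
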